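/- Fix a natural number q ≥ 3 and a real t > 1. Then 𝓑(t,q) ∩ (0,∞) = ∅ if 1 < t < t₃(q), and 𝓑(t,q) ∩ (0,∞) = {z_c^−(t,q), z_c^+(t,q)} if t ≥ t₃(q), where z_c^±(t,q) = [(−3 − 6(q−2)t − 3(2+(q−2)q)t² − 6(q−2)(q−1)t³ + (q−1)²t⁴) ± √((t−1)³(1−t+qt)³(−9+18t−9qt−t²+qt²))] / (8t(1−2t+qt)³). -/

import Mathlib

noncomputable section

/-- The pair `(Z_n^0(z), Z_n^1(z))` of conditional partition functions of the
`q`-state Potts model on the depth-`n` rooted binary Cayley tree, in the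
field-like variable `z` and temperature-like variable `t`. -/
def ZZpair (q : ℕ) (t : ℝ) : ℕ → ℂ → ℂ × ℂ
  | 0, z => (z⁻¹, 1)
  | n + 1, z =>
      (z⁻¹ * ((ZZpair q t n z).1 + ((q : ℂ) - 1) * (t : ℂ) * (ZZpair q t n z).2) ^ 2,
       ((t : ℂ) * (ZZpair q t n z).1 + (1 + ((q : ℂ) - 2) * (t : ℂ)) * (ZZpair q t n z).2) ^ 2)

/-- The full partition function `Z_n(z) = Z_n^0(z) + (q-1)·Z_n^1(z)` of the
rooted binary Cayley tree of depth `n`. -/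
def Zrooted (q : ℕ) (t : ℝ) (n : ℕ) (z : ℂ) : ℂ :=
  (ZZpair q t n z).1 + ((q : ℂ) - 1) * (ZZpair q t n z).2

/-- The accumulation set `𝓑(t,q)` of the Lee–Yang zeros of the rooted binary
Cayley tree: the closure of the set of zeros of some `Z_n` in `ℂ ∖ {0}`. -/
def BLY (t : ℝ) (q : ℕ) : Set ℂ :=
  closure {z : ℂ | z ≠ 0 ∧ ∃ n : ℕ, Zrooted q t n z = 0}

/-- The positive real axis `(0,∞)` viewed as a subset of `ℂ`. -/
def posAxis : Set ℂ := {z : ℂ | ∃ x : ℝ, 0 < x ∧ z = (x : ℂ)}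

/-- `t₃(q) = 3(3q − 6 + √(9q² − 32q + 32))/(2(q − 1))`. -/
def tThree (q : ℝ) : ℝ :=
  3 * (3 * q - 6 + Real.sqrt (9 * q ^ 2 - 32 * q + 32)) / (2 * (q - 1))

/-- `z_c^+(t,q)`. -/
def zcPlus (q t : ℝ) : ℝ :=
  ((-3 - 6 * (q - 2) * t - 3 * (2 + (q - 2) * q) * t ^ 2 - 6 * (q - 2) * (q - 1) * t ^ 3
      + (q - 1) ^ 2 * t ^ 4)
    + Real.sqrt ((t - 1) ^ 3 * (1 - t + q * t) ^ 3 * (-9 + 18 * t - 9 * q * t - t ^ 2 + q * t ^ 2)))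
    / (8 * t * (1 - 2 * t + q * t) ^ 3)

/-- `z_c^−(t,q)`. -/
def zcMinus (q t : ℝ) : ℝ :=
  ((-3 - 6 * (q - 2) * t - 3 * (2 + (q - 2) * q) * t ^ 2 - 6 * (q - 2) * (q - 1) * t ^ 3
      + (q - 1) ^ 2 * t ^ 4)
    - Real.sqrt ((t - 1) ^ 3 * (1 - t + q * t) ^ 3 * (-9 + 18 * t - 9 * q * t - t ^ 2 + q * t ^ 2)))
    / (8 * t * (1 - 2 * t + q * t) ^ 3)

section

open Filter Topology Metric Set

/-- A bounded family of holomorphic functions on a disc that tends to zero pointwise on a set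
accumulating at the centre tends to zero at the centre. -/
theorem tendsto_zero_center_of_bounded {ι : Type*} {l : Filter ι} {f : ι → ℂ → ℂ} {c : ℂ}
    {R C : ℝ} (hR : 0 < R) (hd : ∀ i, DifferentiableOn ℂ (f i) (ball c R))
    (hb : ∀ i, ∀ z ∈ ball c R, ‖f i z‖ ≤ C)
    (hS : ∃ᶠ x in 𝓝[≠] c, Tendsto (fun i => f i x) l (𝓝 0)) :
    Tendsto (fun i => f i c) l (𝓝 0) := by
  rw [Metric.tendsto_nhds]
  intro ε hε
  have hC : 0 ≤ 2 * C / R ∨ ∀ i : ι, False := by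
    by_cases h : Nonempty ι
    · obtain ⟨i⟩ := h
      have := (norm_nonneg _).trans (hb i c (mem_ball_self hR))
      left; positivity
    · right; exact fun i => h ⟨i⟩
  rcases hC with hC | hC
  swap
  · exact Eventually.of_forall fun i => (hC i).elim
  set K := 2 * C / R with hK
  have hnear : ∀ᶠ x in 𝓝[≠] c, x ∈ ball c (min R (ε / (2 * (K + 1)))) := by
    apply nhdsWithin_le_nhds
    apply ball_mem_nhds
    positivity
  obtain ⟨x, hx0, hx⟩ := (hS.and_eventually hnear).exists
  rw [Metric.tendsto_nhds] at hx0
  filter_upwards [hx0 (ε / 2) (by positivity)] with i hi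
  rw [mem_ball, lt_min_iff] at hx
  have hmaps : MapsTo (f i) (ball c R) (closedBall (f i c) (2 * C)) := by
    intro z hz
    rw [mem_closedBall, dist_eq_norm]
    have h1 := hb i z hz
    have h2 := hb i c (mem_ball_self hR)
    linarith [norm_sub_le (f i z) (f i c)]
  have h1 := Complex.dist_le_div_mul_dist_of_mapsTo_ball (hd i) hmaps (mem_ball.2 hx.1)
  rw [dist_zero_right] at hi ⊢
  have h2 : K * dist x c ≤ ε / 2 := by
    have : (K + 1) * dist x c ≤ ε / 2 := by
      have h3 := hx.2.le
      rw [le_div_iff₀ (by positivity)] at h3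
      linarith
    nlinarith [dist_nonneg (x := x) (y := c)]
  have h3 : ‖f i c‖ ≤ ‖f i x‖ + dist (f i x) (f i c) := by
    rw [dist_comm, dist_eq_norm]
    exact norm_le_norm_add_norm_sub' _ _
  linarith

theorem eventually_norm_le_of_bounded {ι : Type*} {l : Filter ι} {c : ℂ} {R : ℝ} (hR : 0 < R)
    (k : ℕ) : ∀ {f : ι → ℂ → ℂ} {C : ℝ}, (∀ i, DifferentiableOn ℂ (f i) (ball c R)) →
    (∀ i, ∀ z ∈ ball c R, ‖f i z‖ ≤ C) →
    (∃ᶠ x in 𝓝[≠] c, Tendsto (fun i => f i x) l (𝓝 0)) → ∀ ε > 0,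
    ∀ᶠ i in l, ∀ z ∈ ball c (R / 4), ‖f i z‖ ≤ C / 2 ^ k + ε := by
  induction k with
  | zero =>
    intro f C hd hb hS ε hε
    refine Eventually.of_forall fun i z hz => ?_
    have := hb i z (ball_subset_ball (by linarith) hz)
    simp only [pow_zero, div_one]
    linarith
  | succ k ih =>
    intro f C hd hb hS ε hε
    have hc := tendsto_zero_center_of_bounded hR hd hb hS
    have hmaps : ∀ i, MapsTo (f i) (ball c R) (closedBall (f i c) (2 * C)) := by
      intro i z hz
      rw [mem_closedBall, dist_eq_norm]
      have h1 := hb i z hz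
      have h2 := hb i c (mem_ball_self hR)
      linarith [norm_sub_le (f i z) (f i c)]
    have key := ih (f := fun i => dslope (f i) c) (C := 2 * C / R)
      (fun i => (Complex.differentiableOn_dslope (ball_mem_nhds c hR)).2 (hd i))
      (fun i z hz => Complex.norm_dslope_le_div_of_mapsTo_ball (hd i) (hmaps i) hz)
      (by
        refine (hS.and_eventually self_mem_nhdsWithin).mono ?_
        rintro x ⟨hx, hxc : x ≠ c⟩
        have : Tendsto (fun i => (x - c)⁻¹ * (f i x - f i c)) l (𝓝 ((x - c)⁻¹ * (0 - 0))) :=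
          (hx.sub hc).const_mul _
        simpa [dslope_of_ne _ hxc, slope_def_module] using this)
      (ε / R) (by positivity)
    rw [Metric.tendsto_nhds] at hc
    filter_upwards [key, hc (ε / 2) (by positivity)] with i hi hic z hz
    rw [dist_zero_right] at hic
    have e : f i z = f i c + (z - c) * dslope (f i) c z := by
      have := sub_smul_dslope (f i) c z
      rw [smul_eq_mul] at this
      rw [this]; ring
    have h1 := hi z hz
    have h2 : ‖z - c‖ ≤ R / 4 := by rw [← dist_eq_norm]; exact (mem_ball.1 hz).le
    calc ‖f i z‖ ≤ ‖f i c‖ + ‖z - c‖ * ‖dslope (f i) c z‖ := by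
          rw [e, ← norm_mul]; exact norm_add_le _ _
      _ ≤ ε / 2 + R / 4 * (2 * C / R / 2 ^ k + ε / R) := by gcongr
      _ = C / 2 ^ (k + 1) + 3 / 4 * ε := by field_simp; ring
      _ ≤ _ := by linarith

/-- **Vitali's theorem** for families tending to zero. -/
theorem tendstoUniformlyOn_zero_of_bounded {ι : Type*} {l : Filter ι} {f : ι → ℂ → ℂ} {c : ℂ}
    {R C : ℝ} (hR : 0 < R) (hd : ∀ i, DifferentiableOn ℂ (f i) (ball c R))
    (hb : ∀ i, ∀ z ∈ ball c R, ‖f i z‖ ≤ C)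
    (hS : ∃ᶠ x in 𝓝[≠] c, Tendsto (fun i => f i x) l (𝓝 0)) {ε : ℝ} (hε : 0 < ε) :
    ∀ᶠ i in l, ∀ z ∈ ball c (R / 4), ‖f i z‖ < ε := by
  have h2 : Tendsto (fun k : ℕ => C / 2 ^ k) atTop (𝓝 0) :=
    tendsto_const_nhds.div_atTop (tendsto_pow_atTop_atTop_of_one_lt one_lt_two)
  obtain ⟨k, hk⟩ := (h2.eventually (gt_mem_nhds (show (0 : ℝ) < ε / 2 by positivity))).exists
  filter_upwards [eventually_norm_le_of_bounded hR k hd hb hS (ε / 3) (by positivity)]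
    with i hi z hz
  linarith [hi z hz]

/-- A nonvanishing holomorphic function on a disc centred on the real line whose real values lie in
the slit plane has a holomorphic logarithm which is principal on the real line. -/
theorem exists_log_eq_principal_on_real {f : ℂ → ℂ} {c R : ℝ} (hR : 0 < R)
    (hd : DifferentiableOn ℂ f (ball (c : ℂ) R)) (h0 : ∀ z ∈ ball (c : ℂ) R, f z ≠ 0)
    (hs : ∀ x : ℝ, (x : ℂ) ∈ ball (c : ℂ) R → f x ∈ Complex.slitPlane) :
    ∃ L : ℂ → ℂ, DifferentiableOn ℂ L (ball (c : ℂ) R) ∧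
      (∀ z ∈ ball (c : ℂ) R, Complex.exp (L z) = f z) ∧
      ∀ x : ℝ, (x : ℂ) ∈ ball (c : ℂ) R → L x = Complex.log (f x) := by
  have hc : (c : ℂ) ∈ ball (c : ℂ) R := mem_ball_self hR
  have hderiv : ∀ z ∈ ball (c : ℂ) R, HasDerivAt f (deriv f z) z := fun z hz =>
    ((hd z hz).differentiableAt (isOpen_ball.mem_nhds hz)).hasDerivAt
  have hquot : DifferentiableOn ℂ (fun z => deriv f z / f z) (ball (c : ℂ) R) :=
    (hd.deriv isOpen_ball).div hd h0
  obtain ⟨L, hLc, hL⟩ := hquot.isExactOn_ball.with_val_at (c : ℂ) (Complex.log (f c))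
  refine ⟨L, fun z hz => (hL z hz).differentiableAt.differentiableWithinAt, fun z hz => ?_,
    fun x hx => ?_⟩
  · have hg : ∀ w ∈ ball (c : ℂ) R, HasDerivAt (fun w => f w * Complex.exp (-L w)) 0 w := by
      intro w hw
      convert! (hderiv w hw).mul (hL w hw).neg.cexp using 1
      field_simp [h0 w hw]
      ring
    have := isOpen_ball.is_const_of_deriv_eq_zero (convex_ball (c : ℂ) R).isPreconnected
      (fun w hw => (hg w hw).differentiableAt.differentiableWithinAt)
      (fun w hw => (hg w hw).deriv) hz hc
    simp only [hLc, Complex.exp_neg, Complex.exp_log (h0 c hc), mul_inv_cancel₀ (h0 c hc)] at this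
    field_simp at this
    exact this.symm
  · have hmem : ∀ y : ℝ, (y : ℂ) ∈ ball (c : ℂ) R ↔ y ∈ ball c R := by
      intro y
      simp [mem_ball, Complex.dist_eq, Real.dist_eq, ← Complex.ofReal_sub, Complex.norm_real]
    have hg : ∀ y ∈ ball c R, HasDerivAt (fun y : ℝ => L y - Complex.log (f y)) 0 y := by
      intro y hy
      have hy' := (hmem y).2 hy
      have := ((hL y hy').sub ((hderiv y hy').clog (hs y hy'))).comp_ofReal
      simpa using this
    have := isOpen_ball.is_const_of_deriv_eq_zero (convex_ball c R).isPreconnected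
      (fun w hw => (hg w hw).differentiableAt.differentiableWithinAt)
      (fun w hw => (hg w hw).deriv) ((hmem x).1 hx) ((hmem c).1 hc)
    simp only [hLc, sub_self] at this
    exact sub_eq_zero.1 this

theorem exists_limit_of_almost_doubling {u : ℕ → ℝ} {K : ℝ}
    (hu : ∀ n, |u (n + 1) - 2 * u n| ≤ K) :
    ∃ ℓ : ℝ, Tendsto (fun n => u n / 2 ^ n) atTop (𝓝 ℓ) ∧ ∀ n, |u n - 2 ^ n * ℓ| ≤ K := by
  have hdist : ∀ n, dist (u n / 2 ^ n) (u (n + 1) / 2 ^ (n + 1)) ≤ K / 2 / 2 ^ n := by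
    intro n
    have h2 : (0 : ℝ) < 2 ^ (n + 1) := by positivity
    rw [Real.dist_eq, abs_sub_comm,
      show u (n + 1) / 2 ^ (n + 1) - u n / 2 ^ n = (u (n + 1) - 2 * u n) / 2 ^ (n + 1) by
        field_simp; ring, abs_div, abs_of_pos h2, div_div, ← pow_succ']
    gcongr
    exact hu n
  obtain ⟨ℓ, hℓ⟩ := cauchySeq_tendsto_of_complete (cauchySeq_of_le_geometric_two hdist)
  refine ⟨ℓ, hℓ, fun n => ?_⟩
  have h := dist_le_of_le_geometric_two_of_tendsto hdist hℓ n
  have h2 : (0 : ℝ) < 2 ^ n := by positivity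
  rw [Real.dist_eq, show u n / 2 ^ n - ℓ = (u n - 2 ^ n * ℓ) / 2 ^ n by field_simp, abs_div,
    abs_of_pos h2] at h
  exact (div_le_div_iff_of_pos_right h2).1 h

theorem tendsto_div_two_pow_of_frequently_close {u v : ℕ → ℝ} {K a b : ℝ}
    (hu : Tendsto (fun n => u n / 2 ^ n) atTop (𝓝 a))
    (hv : Tendsto (fun n => Real.exp (v n / 2 ^ n)) atTop (𝓝 b))
    (h : ∃ᶠ n in atTop, |v n - u n| ≤ K) : b = Real.exp a := by
  have hz : Tendsto (fun n : ℕ => K / 2 ^ n) atTop (𝓝 0) :=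
    tendsto_const_nhds.div_atTop (tendsto_pow_atTop_atTop_of_one_lt one_lt_two)
  obtain ⟨φ, hφ, hφ'⟩ := extraction_of_frequently_atTop h
  have h1 : Tendsto (fun n => v (φ n) / 2 ^ φ n - u (φ n) / 2 ^ φ n) atTop (𝓝 0) := by
    refine squeeze_zero_norm (fun n => ?_) (hz.comp hφ.tendsto_atTop)
    have h2 : (0 : ℝ) < 2 ^ φ n := by positivity
    rw [← sub_div, norm_div, Real.norm_eq_abs, Real.norm_of_nonneg h2.le]
    simp only [Function.comp]
    gcongr
    exact hφ' n
  have h3 : Tendsto (fun n => v (φ n) / 2 ^ φ n) atTop (𝓝 a) := by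
    have := h1.add (hu.comp hφ.tendsto_atTop)
    simpa [Function.comp_def] using this
  exact tendsto_nhds_unique (hv.comp hφ.tendsto_atTop) (h3.rexp)

theorem abs_sub_le_of_frequently {K : ℝ} {ν δ : ℕ → ℝ} (hup : ∀ n, δ n ≤ ν n + K)
    (hlow : ∀ n, ν n ≤ δ n + K ∨ ν (n + 1) ≤ δ (n + 1) + K) :
    ∃ᶠ n in atTop, |δ n - ν n| ≤ K := by
  rw [frequently_atTop]
  intro n
  rcases hlow n with h | h
  · exact ⟨n, le_rfl, abs_le.2 ⟨by linarith, by linarith [hup n]⟩⟩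
  · exact ⟨n + 1, by simp, abs_le.2 ⟨by linarith, by linarith [hup (n + 1)]⟩⟩

/-- If `D n` are nonvanishing holomorphic functions on a disc whose logarithmic size is comparable,
at least once in any two consecutive steps, to an almost doubling sequence `ν n`, then `ν n` is
within bounded distance of `2 ^ n` times the logarithm of the modulus of a single nonvanishing
holomorphic function on a smaller disc. -/
theorem exists_holomorphic_growth_rate {c R K : ℝ} (hR : 0 < R) (hK : 0 ≤ K)
    {D : ℕ → ℂ → ℂ} {ν : ℕ → ℂ → ℝ}
    (hD : ∀ n, DifferentiableOn ℂ (D n) (ball (c : ℂ) R))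
    (h0 : ∀ n, ∀ z ∈ ball (c : ℂ) R, D n z ≠ 0)
    (hpos : ∀ n (x : ℝ), (x : ℂ) ∈ ball (c : ℂ) R → ∃ d : ℝ, 0 < d ∧ D n x = d)
    (hν0 : ∀ z ∈ ball (c : ℂ) R, ν 0 z ≤ K)
    (hν : ∀ n, ∀ z ∈ ball (c : ℂ) R, |ν (n + 1) z - 2 * ν n z| ≤ K)
    (hup : ∀ n, ∀ z ∈ ball (c : ℂ) R, Real.log ‖D n z‖ ≤ ν n z + K)
    (hlow : ∀ n, ∀ z ∈ ball (c : ℂ) R, ν n z ≤ Real.log ‖D n z‖ + K ∨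
      ν (n + 1) z ≤ Real.log ‖D (n + 1) z‖ + K)
    (hreal : ∀ n (x : ℝ), (x : ℂ) ∈ ball (c : ℂ) R → ν n x ≤ Real.log ‖D n x‖ + K) :
    ∃ E : ℂ → ℂ, DifferentiableOn ℂ E (ball (c : ℂ) (R / 4)) ∧
      ∀ z ∈ ball (c : ℂ) (R / 4), E z ≠ 0 ∧ ∀ n, |ν n z - 2 ^ n * Real.log ‖E z‖| ≤ K := by
  have hlim : ∀ z : ℂ, ∃ ℓ : ℝ, z ∈ ball (c : ℂ) R →
      Tendsto (fun n => ν n z / 2 ^ n) atTop (𝓝 ℓ) ∧ ∀ n, |ν n z - 2 ^ n * ℓ| ≤ K := by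
    intro z
    by_cases hz : z ∈ ball (c : ℂ) R
    · obtain ⟨ℓ, hℓ⟩ := exists_limit_of_almost_doubling (u := fun n => ν n z)
        (fun n => hν n z hz)
      exact ⟨ℓ, fun _ => hℓ⟩
    · exact ⟨0, fun h => (hz h).elim⟩
  choose ℓ hℓ using hlim
  have hlog : ∀ n, ∃ L : ℂ → ℂ, DifferentiableOn ℂ L (ball (c : ℂ) R) ∧
      (∀ z ∈ ball (c : ℂ) R, Complex.exp (L z) = D n z) ∧
      ∀ x : ℝ, (x : ℂ) ∈ ball (c : ℂ) R → L x = Complex.log (D n x) := by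
    intro n
    refine exists_log_eq_principal_on_real hR (hD n) (h0 n) (fun x hx => ?_)
    obtain ⟨d, hd, hd'⟩ := hpos n x hx
    rw [hd']
    exact Or.inl (by simpa using hd)
  choose L hLd hLe hLr using hlog
  have hre : ∀ n, ∀ z ∈ ball (c : ℂ) R, (L n z).re = Real.log ‖D n z‖ := by
    intro n z hz
    rw [← hLe n z hz, Complex.norm_exp, Real.log_exp]
  set F : ℕ → ℂ → ℂ := fun n z => Complex.exp (L n z / 2 ^ n) with hF
  have hFnorm : ∀ n, ∀ z ∈ ball (c : ℂ) R, ‖F n z‖ = Real.exp (Real.log ‖D n z‖ / 2 ^ n) := by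
    intro n z hz
    rw [hF, Complex.norm_exp, ← hre n z hz]
    congr 1
    have : (2 : ℂ) ^ n = ((2 ^ n : ℝ) : ℂ) := by push_cast; rfl
    rw [this, Complex.div_ofReal_re]
  have hFd : ∀ n, DifferentiableOn ℂ (F n) (ball (c : ℂ) R) := fun n =>
    ((hLd n).div_const _).cexp
  have hFb : ∀ n, ∀ z ∈ ball (c : ℂ) R, ‖F n z‖ ≤ Real.exp (4 * K) := by
    intro n z hz
    rw [hFnorm n z hz]
    apply Real.exp_le_exp.2
    have h2 : (1 : ℝ) ≤ 2 ^ n := one_le_pow₀ one_le_two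
    rw [div_le_iff₀ (by positivity)]
    have h3 := hup n z hz
    have h4 := (abs_le.1 ((hℓ z hz).2 n)).2
    have h5 := (abs_le.1 ((hℓ z hz).2 0)).1
    have h6 := hν0 z hz
    simp only [pow_zero, one_mul] at h5
    nlinarith
  have hFx : ∀ x : ℝ, (x : ℂ) ∈ ball (c : ℂ) R →
      Tendsto (fun n => F n x) atTop (𝓝 ((Real.exp (ℓ x) : ℝ) : ℂ)) := by
    intro x hx
    have h1 : ∀ n, F n x = ((Real.exp (Real.log ‖D n x‖ / 2 ^ n) : ℝ) : ℂ) := by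
      intro n
      obtain ⟨d, hd, hd'⟩ := hpos n x hx
      simp only [hF]
      rw [hLr n x hx, hd', Complex.norm_real, Real.norm_of_nonneg hd.le, ← Complex.ofReal_log hd.le]
      push_cast
      rfl
    simp_rw [h1]
    refine (Complex.continuous_ofReal.tendsto _).comp ?_
    refine (Real.continuous_exp.tendsto _).comp ?_
    have h2 : Tendsto (fun n => (Real.log ‖D n x‖ - ν n x) / 2 ^ n) atTop (𝓝 0) := by
      have hz : Tendsto (fun n : ℕ => K / 2 ^ n) atTop (𝓝 0) :=
        tendsto_const_nhds.div_atTop (tendsto_pow_atTop_atTop_of_one_lt one_lt_two)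
      refine squeeze_zero_norm (fun n => ?_) hz
      have h2 : (0 : ℝ) < 2 ^ n := by positivity
      rw [norm_div, Real.norm_eq_abs, Real.norm_of_nonneg h2.le]
      gcongr
      exact abs_le.2 ⟨by linarith [hreal n x hx], by linarith [hup n x hx]⟩
    have := h2.add (hℓ x hx).1
    simpa [← add_div] using this
  have hcauchy : UniformCauchySeqOn F atTop (ball (c : ℂ) (R / 4)) := by
    rw [Metric.uniformCauchySeqOn_iff]
    intro ε hε
    have hvit := tendstoUniformlyOn_zero_of_bounded (ι := ℕ × ℕ) (l := atTop)
      (f := fun p z => F p.1 z - F p.2 z) (c := (c : ℂ)) (R := R) (C := 2 * Real.exp (4 * K)) hR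
      (fun p => (hFd p.1).sub (hFd p.2))
      (fun p z hz => by
        have h1 := hFb p.1 z hz
        have h2 := hFb p.2 z hz
        linarith [norm_sub_le (F p.1 z) (F p.2 z)])
      (by
        have hfr : ∃ᶠ x : ℝ in 𝓝[≠] c, (x : ℂ) ∈ ball (c : ℂ) R := by
          apply Eventually.frequently
          apply nhdsWithin_le_nhds
          exact Complex.continuous_ofReal.continuousAt.eventually
            (isOpen_ball.mem_nhds (mem_ball_self hR))
        have hmap : Tendsto (fun x : ℝ => (x : ℂ)) (𝓝[≠] c) (𝓝[≠] (c : ℂ)) := by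
          refine tendsto_nhdsWithin_iff.2 ⟨?_, ?_⟩
          · exact (Complex.continuous_ofReal.tendsto c).mono_left nhdsWithin_le_nhds
          · filter_upwards [self_mem_nhdsWithin] with x hx
            simpa using hx
        refine hmap.frequently (hfr.mono fun x hx => ?_)
        have h1 := (hFx x hx)
        rw [← prod_atTop_atTop_eq]
        have := (h1.comp tendsto_fst).sub (h1.comp (tendsto_snd (f := (atTop : Filter ℕ))
          (g := (atTop : Filter ℕ))))
        simpa [Function.comp_def] using this) hε
    rw [eventually_atTop] at hvit
    obtain ⟨⟨a, b⟩, hab⟩ := hvit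
    refine ⟨max a b, fun m hm n hn z hz => ?_⟩
    rw [dist_eq_norm]
    exact hab (m, n) ⟨(le_max_left _ _).trans hm, (le_max_right _ _).trans hn⟩ z hz
  have hsub : ball (c : ℂ) (R / 4) ⊆ ball (c : ℂ) R := ball_subset_ball (by linarith)
  have hpt : ∀ z : ℂ, ∃ e : ℂ, z ∈ ball (c : ℂ) (R / 4) → Tendsto (fun n => F n z) atTop (𝓝 e) := by
    intro z
    by_cases hz : z ∈ ball (c : ℂ) (R / 4)
    · obtain ⟨e, he⟩ := cauchySeq_tendsto_of_complete (hcauchy.cauchySeq hz)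
      exact ⟨e, fun _ => he⟩
    · exact ⟨0, fun h => (hz h).elim⟩
  choose E hE using hpt
  have hunif := hcauchy.tendstoUniformlyOn_of_tendsto (f := E) hE
  refine ⟨E, hunif.tendstoLocallyUniformlyOn.differentiableOn
    (Eventually.of_forall fun n => (hFd n).mono hsub) isOpen_ball, fun z hz => ?_⟩
  have hz' := hsub hz
  have hnorm : ‖E z‖ = Real.exp (ℓ z) := by
    refine tendsto_div_two_pow_of_frequently_close (K := K) (u := fun n => ν n z)
      (v := fun n => Real.log ‖D n z‖) (hℓ z hz').1 ?_
      (abs_sub_le_of_frequently (fun n => hup n z hz') (fun n => hlow n z hz'))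
    have := (hE z hz).norm
    simpa only [hFnorm _ z hz'] using this
  refine ⟨fun h => ?_, fun n => ?_⟩
  · rw [h, norm_zero] at hnorm
    exact (Real.exp_pos _).ne hnorm
  · rw [hnorm, Real.log_exp]
    exact (hℓ z hz').2 n

/-- Holomorphic functions of size at most `exp ∘ ν n` whose relative size tends to zero at points
accumulating at the centre have relative size tending to zero on a smaller disc. -/
theorem tendsto_div_exp_growth_zero {c : ℂ} {R K : ℝ} (hR : 0 < R)
    {E : ℂ → ℂ} {X : ℕ → ℂ → ℂ} {ν : ℕ → ℂ → ℝ} (hE : DifferentiableOn ℂ E (ball c R))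
    (hEν : ∀ z ∈ ball c R, E z ≠ 0 ∧ ∀ n, |ν n z - 2 ^ n * Real.log ‖E z‖| ≤ K)
    (hX : ∀ n, DifferentiableOn ℂ (X n) (ball c R))
    (hXb : ∀ n, ∀ z ∈ ball c R, ‖X n z‖ ≤ K * Real.exp (ν n z))
    (hS : ∃ᶠ x in 𝓝[≠] c, Tendsto (fun n => ‖X n x‖ / Real.exp (ν n x)) atTop (𝓝 0)) :
    ∀ z ∈ ball c (R / 4), Tendsto (fun n => ‖X n z‖ / Real.exp (ν n z)) atTop (𝓝 0) := by
  have hcomp : ∀ n, ∀ z ∈ ball c R, Real.exp (ν n z) ≤ Real.exp K * ‖E z ^ 2 ^ n‖ ∧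
      ‖E z ^ 2 ^ n‖ ≤ Real.exp K * Real.exp (ν n z) := by
    intro n z hz
    obtain ⟨h0, h1⟩ := hEν z hz
    have h2 := abs_le.1 (h1 n)
    have h3 : ‖E z ^ 2 ^ n‖ = Real.exp (2 ^ n * Real.log ‖E z‖) := by
      rw [norm_pow, mul_comm, Real.exp_mul, Real.exp_log (norm_pos_iff.2 h0)]
      rw [← Real.rpow_natCast]
      push_cast
      rfl
    rw [h3, ← Real.exp_add, ← Real.exp_add, Real.exp_le_exp, Real.exp_le_exp]
    constructor <;> linarith [h2.1, h2.2]
  have hsub : ball c (R / 4) ⊆ ball c R := ball_subset_ball (by linarith)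
  have hpos : ∀ n, ∀ z ∈ ball c R, 0 < ‖E z ^ 2 ^ n‖ := fun n z hz =>
    norm_pos_iff.2 (pow_ne_zero _ (hEν z hz).1)
  have hquot : ∀ n, DifferentiableOn ℂ (fun z => X n z / E z ^ 2 ^ n) (ball c R) := fun n =>
    (hX n).fun_div (hE.fun_pow _) fun z hz => pow_ne_zero _ (hEν z hz).1
  have hbound : ∀ n, ∀ z ∈ ball c R, ‖X n z / E z ^ 2 ^ n‖ ≤ |K| * Real.exp K := by
      intro n z hz
      rw [norm_div, div_le_iff₀ (hpos n z hz)]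
      calc ‖X n z‖ ≤ K * Real.exp (ν n z) := hXb n z hz
        _ ≤ |K| * Real.exp (ν n z) := by gcongr; exact le_abs_self K
        _ ≤ |K| * (Real.exp K * ‖E z ^ 2 ^ n‖) := by gcongr; exact (hcomp n z hz).1
        _ = _ := by ring
  have hfreq : ∃ᶠ x in 𝓝[≠] c, Tendsto (fun n => X n x / E x ^ 2 ^ n) atTop (𝓝 0) := by
      have hball : ∀ᶠ x in 𝓝[≠] c, x ∈ ball c R := nhdsWithin_le_nhds (ball_mem_nhds c hR)
      refine (hS.and_eventually hball).mono ?_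
      rintro x ⟨hx, hxR⟩
      refine squeeze_zero_norm (a := fun n => Real.exp K * (‖X n x‖ / Real.exp (ν n x)))
        (fun n => ?_) (by simpa using hx.const_mul (Real.exp K))
      rw [norm_div, ← mul_div_assoc, div_le_div_iff₀ (hpos n x hxR) (Real.exp_pos _)]
      calc _ ≤ ‖X n x‖ * (Real.exp K * ‖E x ^ 2 ^ n‖) := by gcongr; exact (hcomp n x hxR).1
        _ = _ := by ring
  intro z hz
  rw [Metric.tendsto_nhds]
  intro ε hε
  filter_upwards [tendstoUniformlyOn_zero_of_bounded hR hquot hbound hfreq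
    (show 0 < ε / Real.exp K by positivity)] with n hn
  have hz' := hsub hz
  have h1 := hn z hz
  rw [dist_zero_right, norm_div, norm_norm, Real.norm_of_nonneg (Real.exp_pos _).le,
    div_lt_iff₀ (Real.exp_pos _)]
  rw [norm_div, div_lt_iff₀ (hpos n z hz')] at h1
  calc _ < ε / Real.exp K * ‖E z ^ 2 ^ n‖ := h1
    _ ≤ ε / Real.exp K * (Real.exp K * Real.exp (ν n z)) := by gcongr; exact (hcomp n z hz').2
    _ = _ := by field_simp

/-- The Potts recursion in the coordinate `u = t · Z⁰ / Z¹`. -/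
def pottsMap {K : Type*} [Field K] (s P κ u : K) : K := κ * ((u + s) / (u + P)) ^ 2

/-- The parameter at which `y` is a fixed point of `pottsMap s P`. -/
def pottsParam {K : Type*} [Field K] (s P y : K) : K := y * ((y + P) / (y + s)) ^ 2

theorem ofReal_pottsMap (s P κ u : ℝ) :
    ((pottsMap s P κ u : ℝ) : ℂ) = pottsMap (s : ℂ) P κ u := by
  simp [pottsMap]

theorem ofReal_pottsParam (s P y : ℝ) :
    ((pottsParam s P y : ℝ) : ℂ) = pottsParam (s : ℂ) P y := by
  simp [pottsParam]

theorem pottsMap_pottsParam {K : Type*} [Field K] {s P y : K} (hs : y + s ≠ 0) (hP : y + P ≠ 0) :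
    pottsMap s P (pottsParam s P y) y = y := by
  simp only [pottsMap, pottsParam]
  field_simp

theorem hasDerivAt_pottsMap {𝕜 : Type*} [NontriviallyNormedField 𝕜] {s P κ u : 𝕜}
    (hs : u + s ≠ 0) (hP : u + P ≠ 0) :
    HasDerivAt (pottsMap s P κ) (-(2 * (s - P) * pottsMap s P κ u / ((u + s) * (u + P)))) u := by
  have h1 : HasDerivAt (fun u : 𝕜 => u + s) 1 u := (hasDerivAt_id u).add_const s
  have h2 : HasDerivAt (fun u : 𝕜 => u + P) 1 u := (hasDerivAt_id u).add_const P
  convert! ((h1.div h2 hP).pow 2).const_mul κ using 1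
  simp only [pottsMap, Pi.div_apply]
  rw [show s - P = (u + s) - (u + P) by ring]
  generalize u + s = x at *
  generalize u + P = y at *
  simp only [mul_one, one_mul, Nat.cast_ofNat, Nat.add_one_sub_one, pow_one]
  field_simp
  ring

theorem pottsMap_pos {s P κ u : ℝ} (hs : 0 < s) (hP : 0 < P) (hκ : 0 < κ) (hu : 0 < u) :
    0 < pottsMap s P κ u := by
  simp only [pottsMap]
  positivity

theorem pottsParam_pos {s P y : ℝ} (hs : 0 < s) (hP : 0 < P) (hy : 0 < y) :
    0 < pottsParam s P y := by
  simp only [pottsParam]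
  positivity

theorem pottsMap_strictAntiOn {s P κ : ℝ} (hP : 0 < P) (hsP : P < s) (hκ : 0 < κ) :
    StrictAntiOn (pottsMap s P κ) (Ioi 0) := by
  intro u hu v hv huv
  have hu : 0 < u := hu
  have hv : 0 < v := hv
  simp only [pottsMap]
  have h1 : (v + s) / (v + P) < (u + s) / (u + P) := by
    rw [div_lt_div_iff₀ (by positivity) (by positivity)]
    nlinarith
  have h0 : 0 < (v + s) / (v + P) := by
    have : 0 < s := hP.trans hsP
    positivity
  gcongr

theorem pottsParam_strictMonoOn {s P : ℝ} (hP : 0 < P) (hsP : P < s) :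
    StrictMonoOn (pottsParam s P) (Ioi 0) := by
  intro u hu v hv huv
  have hu : 0 < u := hu
  have hv : 0 < v := hv
  have hs : 0 < s := hP.trans hsP
  simp only [pottsParam]
  have h1 : (u + P) / (u + s) < (v + P) / (v + s) := by
    rw [div_lt_div_iff₀ (by positivity) (by positivity)]
    nlinarith
  gcongr

theorem iterate_pottsMap_pos {s P κ c : ℝ} (hs : 0 < s) (hP : 0 < P) (hκ : 0 < κ) (hc : 0 < c)
    (n : ℕ) : 0 < (pottsMap s P κ)^[n] c := by
  induction n with
  | zero => exact hc
  | succ n ih => rw [Function.iterate_succ_apply']; exact pottsMap_pos hs hP hκ ih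

theorem eq_of_iterate_pottsMap_eq {s P κ : ℝ} (hP : 0 < P) (hsP : P < s) (hκ : 0 < κ) (n : ℕ) :
    ∀ {u v : ℝ}, 0 < u → 0 < v → (pottsMap s P κ)^[n] u = (pottsMap s P κ)^[n] v → u = v := by
  have hs : 0 < s := hP.trans hsP
  induction n with
  | zero => intro u v _ _ h; exact h
  | succ n ih =>
    intro u v hu hv h
    rw [Function.iterate_succ_apply', Function.iterate_succ_apply'] at h
    exact ih hu hv ((pottsMap_strictAntiOn hP hsP hκ).injOn
      (iterate_pottsMap_pos hs hP hκ hu n) (iterate_pottsMap_pos hs hP hκ hv n) h)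

/-- An orbit converging to a repelling fixed point lands on it. -/
theorem exists_eq_of_tendsto_repelling {𝕜 : Type*} [NontriviallyNormedField 𝕜] {f : 𝕜 → 𝕜}
    {p m : 𝕜} {u : ℕ → 𝕜} (hf : HasDerivAt f m p) (hp : f p = p) (hm : 1 < ‖m‖)
    (hu : ∀ᶠ n in atTop, u (n + 1) = f (u n)) (hlim : Tendsto u atTop (𝓝 p)) :
    ∃ n, u n = p := by
  have hε : 0 < ‖m‖ - 1 := by linarith
  have h1 : ∀ᶠ x in 𝓝 p, ‖x - p‖ ≤ ‖f x - p‖ := by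
    filter_upwards [(hasDerivAt_iff_isLittleO.1 hf).def hε] with x hx
    rw [hp, smul_eq_mul] at hx
    have h2 : ‖(x - p) * m‖ = ‖x - p‖ * ‖m‖ := norm_mul _ _
    have h3 : ‖(x - p) * m‖ ≤ ‖f x - p‖ + ‖f x - p - (x - p) * m‖ := by
      have := norm_sub_le (f x - p) (f x - p - (x - p) * m)
      simpa using this
    nlinarith
  obtain ⟨N, hN⟩ := eventually_atTop.1 (hu.and (hlim.eventually h1))
  refine ⟨N, ?_⟩
  have h2 : ∀ k, ‖u N - p‖ ≤ ‖u (N + k) - p‖ := by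
    intro k
    induction k with
    | zero => exact le_rfl
    | succ k ih =>
      obtain ⟨h3, h4⟩ := hN (N + k) (by omega)
      rw [← add_assoc, h3]
      exact ih.trans h4
  have h3 : Tendsto (fun k => ‖u (N + k) - p‖) atTop (𝓝 0) := by
    have h4 : Tendsto (fun k => u (N + k)) atTop (𝓝 p) := by
      simpa [Function.comp_def, add_comm] using hlim.comp (tendsto_add_atTop_nat N)
    simpa using (h4.sub_const p).norm
  have h4 : ‖u N - p‖ ≤ 0 := ge_of_tendsto' h3 h2
  exact sub_eq_zero.1 (norm_le_zero_iff.1 h4)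

theorem exists_limit_even_iterates {s P κ c : ℝ} (hP : 0 < P) (hsP : P < s) (hκ : 0 < κ)
    (hc : 0 < c) :
    ∃ a : ℝ, 0 < a ∧ Tendsto (fun n => (pottsMap s P κ)^[2 * n] c) atTop (𝓝 a) ∧
      pottsMap s P κ (pottsMap s P κ a) = a := by
  have hs : 0 < s := hP.trans hsP
  set f := pottsMap s P κ with hf
  have hpos := iterate_pottsMap_pos hs hP hκ hc
  have hanti := pottsMap_strictAntiOn hP hsP hκ
  have hstep : ∀ n, f^[2 * (n + 1)] c = f (f (f^[2 * n] c)) := by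
    intro n
    rw [show 2 * (n + 1) = (2 * n + 1) + 1 by ring, Function.iterate_succ_apply',
      Function.iterate_succ_apply']
  have hfpos : ∀ {u : ℝ}, 0 < u → 0 < f u := fun hu => pottsMap_pos hs hP hκ hu
  have hmono : ∀ {u v : ℝ}, 0 < u → 0 < v → u ≤ v → f (f u) ≤ f (f v) := fun hu hv huv =>
    hanti.antitoneOn (hfpos hv) (hfpos hu) (hanti.antitoneOn hu hv huv)
  have hlow : ∀ {u : ℝ}, 0 < u → κ ≤ f u := by
    intro u hu
    simp only [hf, pottsMap]
    have : 1 ≤ (u + s) / (u + P) := by rw [le_div_iff₀ (by positivity)]; linarith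
    nlinarith [one_le_pow₀ (n := 2) this]
  have hup : ∀ {u : ℝ}, 0 < u → f u ≤ κ * (s / P) ^ 2 := by
    intro u hu
    simp only [hf, pottsMap]
    have : (u + s) / (u + P) ≤ s / P := by
      rw [div_le_div_iff₀ (by positivity) (by positivity)]; nlinarith
    gcongr
  have hlow' : ∀ n, κ ≤ f^[2 * (n + 1)] c := by
    intro n; rw [hstep]; exact hlow (hfpos (hpos _))
  have hup' : ∀ n, f^[2 * (n + 1)] c ≤ κ * (s / P) ^ 2 := by
    intro n; rw [hstep]; exact hup (hfpos (hpos _))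
  obtain ⟨a, ha⟩ : ∃ a, Tendsto (fun n => f^[2 * (n + 1)] c) atTop (𝓝 a) := by
    rcases le_total (f^[2 * 0] c) (f^[2 * 1] c) with h | h
    · have hm : ∀ n, f^[2 * n] c ≤ f^[2 * (n + 1)] c := by
        intro n
        induction n with
        | zero => exact h
        | succ n ih => rw [hstep, hstep (n + 1)]; exact hmono (hpos _) (hpos _) ih
      exact ⟨_, tendsto_atTop_ciSup (monotone_nat_of_le_succ fun n => hm (n + 1))
        ⟨_, by rintro _ ⟨n, rfl⟩; exact hup' n⟩⟩
    · have hm : ∀ n, f^[2 * (n + 1)] c ≤ f^[2 * n] c := by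
        intro n
        induction n with
        | zero => exact h
        | succ n ih =>
          exact (hstep (n + 1)).trans_le ((hmono (hpos _) (hpos _) ih).trans_eq (hstep n).symm)
      exact ⟨_, tendsto_atTop_ciInf (antitone_nat_of_succ_le fun n => hm (n + 1))
        ⟨_, by rintro _ ⟨n, rfl⟩; exact hlow' n⟩⟩
  have hapos : 0 < a := hκ.trans_le (ge_of_tendsto' ha hlow')
  have hcont : ∀ {u : ℝ}, 0 < u → ContinuousAt f u := fun {u} hu =>
    (hasDerivAt_pottsMap (by positivity : u + s ≠ 0) (by positivity : u + P ≠ 0)).continuousAt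
  have ha' : Tendsto (fun n => f^[2 * n] c) atTop (𝓝 a) :=
    (tendsto_add_atTop_iff_nat (f := fun n => f^[2 * n] c) 1).1 ha
  refine ⟨a, hapos, ha', ?_⟩
  have h1 : Tendsto (fun n => f (f (f^[2 * n] c))) atTop (𝓝 (f (f a))) :=
    ((hcont (hfpos hapos)).tendsto.comp (hcont hapos).tendsto).comp ha'
  simp_rw [← hstep] at h1
  exact tendsto_nhds_unique h1 ha

theorem tendsto_iterates_of_even {s P κ c a : ℝ} (hs : 0 < s) (hP : 0 < P) (ha : 0 < a)
    (hlim : Tendsto (fun n => (pottsMap s P κ)^[2 * n] c) atTop (𝓝 a))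
    (hfix : pottsMap s P κ a = a) :
    Tendsto (fun n => (pottsMap s P κ)^[n] c) atTop (𝓝 a) := by
  have hcont : ContinuousAt (pottsMap s P κ) a :=
    (hasDerivAt_pottsMap (by positivity) (by positivity)).continuousAt
  have hodd : Tendsto (fun n => (pottsMap s P κ)^[2 * n + 1] c) atTop (𝓝 a) := by
    have h1 := hcont.tendsto.comp hlim
    rw [hfix] at h1
    refine h1.congr fun n => ?_
    simp only [Function.comp_apply]
    exact (Function.iterate_succ_apply' _ _ _).symm
  rw [Metric.tendsto_atTop] at hlim hodd ⊢
  intro ε hε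
  obtain ⟨N, hN⟩ := hlim ε hε
  obtain ⟨M, hM⟩ := hodd ε hε
  refine ⟨2 * (N + M), fun n hn => ?_⟩
  rcases Nat.even_or_odd' n with ⟨k, rfl | rfl⟩
  · exact hN k (by omega)
  · exact hM k (by omega)

/-- Data attached to a genuine positive two-cycle of the Potts recursion. -/
theorem two_cycle_estimates {s P κ a b : ℝ} (hP : 0 < P) (hsP : P < s) (hκ : 0 < κ) (ha : 0 < a)
    (hb : 0 < b) (hab : a ≠ b) (hfa : pottsMap s P κ a = b) (hfb : pottsMap s P κ b = a) :
    4 * (s - P) ^ 2 * (a * b) < (a + s) * (a + P) * ((b + s) * (b + P)) ∧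
    ∃ p, P < p ∧ p < s ∧ κ * (s - p) = P * (p - P) ∧ p ^ 2 - (s - 3 * P) * p + s * P < 0 := by
  have hs : 0 < s := hP.trans hsP
  obtain ⟨α, hα, rfl⟩ : ∃ α : ℝ, 0 < α ∧ α ^ 2 = a := ⟨√a, by positivity, Real.sq_sqrt ha.le⟩
  obtain ⟨β, hβ, rfl⟩ : ∃ β : ℝ, 0 < β ∧ β ^ 2 = b := ⟨√b, by positivity, Real.sq_sqrt hb.le⟩
  have hαβ : α ≠ β := fun h => hab (by rw [h])
  simp only [pottsMap] at hfa hfb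
  have e1 : κ * (α ^ 2 + s) ^ 2 = β ^ 2 * (α ^ 2 + P) ^ 2 := by
    rw [div_pow, mul_div_assoc', div_eq_iff (by positivity)] at hfa; exact hfa
  have e2 : κ * (β ^ 2 + s) ^ 2 = α ^ 2 * (β ^ 2 + P) ^ 2 := by
    rw [div_pow, mul_div_assoc', div_eq_iff (by positivity)] at hfb; exact hfb
  have e3 : β * (α ^ 2 + P) * (β ^ 2 + s) = α * (β ^ 2 + P) * (α ^ 2 + s) := by
    refine (pow_left_inj₀ (by positivity) (by positivity) two_ne_zero).1 ?_
    linear_combination (-(β ^ 2 + s) ^ 2) * e1 + (α ^ 2 + s) ^ 2 * e2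
  have e4 : P * (α + β) ^ 2 = (s - α * β) * (α * β - P) := by
    have : (β - α) * (P * (α + β) ^ 2 - (s - α * β) * (α * β - P)) = 0 := by
      linear_combination e3
    rcases mul_eq_zero.1 this with h | h
    · exact (hαβ (by linarith)).elim
    · linarith
  have hdisc : 4 * (α * β) < (α + β) ^ 2 := by
    have : 0 < (α - β) ^ 2 := by have := sub_ne_zero.2 hαβ; positivity
    nlinarith
  have hp0 : 0 < α * β := by positivity
  have hp1 : P < α * β := by
    by_contra! h
    nlinarith
  have hp2 : α * β < s := by
    by_contra! h
    nlinarith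
  have e5 : (α ^ 2 + P) * (β ^ 2 + P) = (α * β - P) * (s - P) := by
    linear_combination e4
  have e6 : P * ((α ^ 2 + s) * (β ^ 2 + s)) = (s - α * β) * (α * β) * (s - P) := by
    linear_combination s * e4
  refine ⟨?_, α * β, hp1, hp2, ?_, ?_⟩
  · have e7 : (α ^ 2 + s) * (α ^ 2 + P) * ((β ^ 2 + s) * (β ^ 2 + P)) =
        (s - P) ^ 2 * (α * β) * (α + β) ^ 2 := by
      refine mul_left_cancel₀ hP.ne' ?_
      linear_combination (α ^ 2 + P) * (β ^ 2 + P) * e6 + (s - α * β) * (α * β) * (s - P) * e5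
        - (s - P) ^ 2 * (α * β) * e4
    rw [e7]
    have : 0 < (s - P) ^ 2 * (α * β) := by
      positivity
    nlinarith
  · have e8 : κ * ((α ^ 2 + s) * (β ^ 2 + s)) = α * β * ((α ^ 2 + P) * (β ^ 2 + P)) := by
      refine (pow_left_inj₀ (by positivity) (by positivity) two_ne_zero).1 ?_
      linear_combination κ * (β ^ 2 + s) ^ 2 * e1 + β ^ 2 * (α ^ 2 + P) ^ 2 * e2
    have hne : α * β * (s - P) ≠ 0 := mul_ne_zero hp0.ne' (sub_pos.2 hsP).ne'
    refine mul_left_cancel₀ hne ?_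
    linear_combination P * e8 - κ * e6 + α * β * P * e5
  · nlinarith

/-- The parameter of a parabolic fixed point `y`. -/
theorem pottsParam_of_root {s P y : ℝ} (hs : 0 < s) (hy : 0 < y)
    (hroot : y ^ 2 - (s - 3 * P) * y + s * P = 0) :
    pottsParam s P y * (s - y) = P * (y - P) := by
  simp only [pottsParam]
  field_simp
  linear_combination (s * P - y ^ 2) * hroot

theorem root_bounds {s P y : ℝ} (hP : 0 < P) (hsP : P < s) (hy : 0 < y)
    (hroot : y ^ 2 - (s - 3 * P) * y + s * P = 0) : P < y ∧ y < s := by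
  have hs : 0 < s := hP.trans hsP
  constructor
  · by_contra! h
    nlinarith [mul_nonneg hs.le (sub_nonneg.2 h), mul_pos hP hy]
  · by_contra! h
    nlinarith [mul_nonneg hy.le (sub_nonneg.2 h), mul_pos hP hy, mul_pos hs hP]

theorem no_two_cycle {s P y x a : ℝ} (hP : 0 < P) (hsP : P < s) (hy : 0 < y)
    (hroot : y ^ 2 - (s - 3 * P) * y + s * P = 0) (hx : 0 < x)
    (hside : (y ^ 2 ≤ s * P ∧ x ≤ y) ∨ (s * P ≤ y ^ 2 ∧ y ≤ x)) (ha : 0 < a)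
    (hcycle : pottsMap s P (pottsParam s P x) (pottsMap s P (pottsParam s P x) a) = a) : a = x := by
  have hs : 0 < s := hP.trans hsP
  have hκ := pottsParam_pos hs hP hx
  have hanti := pottsMap_strictAntiOn hP hsP hκ
  have hfa := pottsMap_pos hs hP hκ ha
  have hfix : pottsMap s P (pottsParam s P x) a = a := by
    by_contra hne
    obtain ⟨-, p, hp1, hp2, hp3, hp4⟩ := two_cycle_estimates hP hsP hκ ha hfa
      (Ne.symm hne) rfl hcycle
    have hy3 := pottsParam_of_root hs hy hroot
    obtain ⟨hy1, hy2⟩ := root_bounds hP hsP hy hroot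
    have hκy := pottsParam_pos hs hP hy
    rcases hside with ⟨h1, h2⟩ | ⟨h1, h2⟩
    · have hκle := (pottsParam_strictMonoOn hP hsP).monotoneOn hx hy h2
      have hyp : y < p := by
        by_contra! h
        nlinarith [mul_nonneg hy.le (sub_nonneg.2 h)]
      nlinarith
    · have hκle := (pottsParam_strictMonoOn hP hsP).monotoneOn hy hx h2
      have hyp : p < y := by
        by_contra! h
        nlinarith [mul_nonneg hy.le (sub_nonneg.2 h)]
      have h4 : pottsParam s P y * (s - y) < pottsParam s P y * (s - p) :=
        mul_lt_mul_of_pos_left (by linarith) hκy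
      nlinarith
  have hx' : pottsMap s P (pottsParam s P x) x = x :=
    pottsMap_pottsParam (by positivity) (by positivity)
  rcases lt_trichotomy a x with h | h | h
  · have := hanti ha hx h
    rw [hfix, hx'] at this
    linarith
  · exact h
  · have := hanti hx ha h
    rw [hfix, hx'] at this
    linarith

/-- On the real line outside the two-cycle region the orbit converges to the fixed point. -/
theorem tendsto_iterates_fixed_point {s P y x c : ℝ} (hP : 0 < P) (hsP : P < s) (hy : 0 < y)
    (hroot : y ^ 2 - (s - 3 * P) * y + s * P = 0) (hx : 0 < x) (hc : 0 < c)
    (hside : (y ^ 2 ≤ s * P ∧ x ≤ y) ∨ (s * P ≤ y ^ 2 ∧ y ≤ x)) :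
    Tendsto (fun n => (pottsMap s P (pottsParam s P x))^[n] c) atTop (𝓝 x) := by
  have hs : 0 < s := hP.trans hsP
  have hκ := pottsParam_pos hs hP hx
  obtain ⟨a, ha, hlim, hfix⟩ := exists_limit_even_iterates hP hsP hκ hc
  obtain rfl := no_two_cycle hP hsP hy hroot hx hside ha hfix
  exact tendsto_iterates_of_even hs hP ha hlim (pottsMap_pottsParam (by positivity) (by positivity))

/-- Away from the parabolic parameters the even iterates converge to an attracting fixed point of
the second iterate. -/
theorem exists_attracting_limit {s P κ c : ℝ} (hP : 0 < P) (hsP : P < s) (hκ : 0 < κ) (hc : 0 < c)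
    (hmc : 2 * (s - P) * c < (c + s) * (c + P))
    (hκy : ∀ y, 0 < y → y ^ 2 - (s - 3 * P) * y + s * P = 0 → pottsParam s P y ≠ κ) :
    ∃ a : ℝ, 0 < a ∧ Tendsto (fun n => (pottsMap s P κ)^[2 * n] c) atTop (𝓝 a) ∧
      pottsMap s P κ (pottsMap s P κ a) = a ∧
      4 * (s - P) ^ 2 * (a * pottsMap s P κ a) <
        (a + s) * (a + P) * ((pottsMap s P κ a + s) * (pottsMap s P κ a + P)) := by
  have hs : 0 < s := hP.trans hsP
  obtain ⟨a, ha, hlim, hfix⟩ := exists_limit_even_iterates hP hsP hκ hc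
  refine ⟨a, ha, hlim, hfix, ?_⟩
  by_cases hfa : pottsMap s P κ a = a
  · have hlt : 2 * (s - P) * a < (a + s) * (a + P) := by
      rcases lt_trichotomy (2 * (s - P) * a) ((a + s) * (a + P)) with h | h | h
      · exact h
      · refine (hκy a ha (by linear_combination -h) ?_).elim
        simp only [pottsMap, pottsParam] at hfa ⊢
        nth_rewrite 1 [← hfa]
        field_simp
      · have hder := hasDerivAt_pottsMap (s := s) (P := P) (κ := κ) (u := a)
          (by positivity) (by positivity)
        rw [hfa] at hder
        obtain ⟨n, hn⟩ := exists_eq_of_tendsto_repelling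
          (u := fun n => (pottsMap s P κ)^[n] c) hder hfa
          (by
            rw [norm_neg, Real.norm_of_nonneg (by positivity), lt_div_iff₀ (by positivity)]
            linarith)
          (Eventually.of_forall fun n => Function.iterate_succ_apply' _ _ _)
          (tendsto_iterates_of_even hs hP ha hlim hfa)
        have hn' : (pottsMap s P κ)^[n] a = a := Function.iterate_fixed hfa n
        obtain rfl := eq_of_iterate_pottsMap_eq hP hsP hκ n hc ha (hn.trans hn'.symm)
        linarith
    rw [hfa]
    have h0 : 0 < 2 * (s - P) * a := by positivity
    nlinarith
  · exact (two_cycle_estimates hP hsP hκ ha (pottsMap_pos hs hP hκ ha) (Ne.symm hfa) rfl hfix).1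

/-- The homogeneous lift of `pottsMap` to `ℂ × ℂ`. -/
def pottsStep (s P κ : ℂ) (v : ℂ × ℂ) : ℂ × ℂ :=
  (κ * (v.1 + s * v.2) ^ 2, (v.1 + P * v.2) ^ 2)

/-- The homogeneous lift of the `pottsMap`-orbit of `c`. -/
def pottsLift (s P c κ : ℂ) (n : ℕ) : ℂ × ℂ := (pottsStep s P κ)^[n] (c, 1)

theorem pottsLift_zero (s P c κ : ℂ) : pottsLift s P c κ 0 = (c, 1) := rfl

theorem pottsLift_succ (s P c κ : ℂ) (n : ℕ) :
    pottsLift s P c κ (n + 1) = pottsStep s P κ (pottsLift s P c κ n) :=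
  Function.iterate_succ_apply' _ _ _

theorem norm_pottsStep_le {s P M : ℝ} (hP : 0 < P) (hsP : P < s) {κ : ℂ} (hκ : ‖κ‖ ≤ M)
    (v : ℂ × ℂ) : ‖pottsStep s P κ v‖ ≤ (M + 1) * (1 + s) ^ 2 * ‖v‖ ^ 2 := by
  have hs : 0 < s := hP.trans hsP
  have hM : 0 ≤ M := (norm_nonneg κ).trans hκ
  have h1 : ‖v.1‖ ≤ ‖v‖ := norm_fst_le v
  have h2 : ‖v.2‖ ≤ ‖v‖ := norm_snd_le v
  have key : ∀ r : ℝ, 0 < r → r ≤ s → ‖(v.1 + r * v.2) ^ 2‖ ≤ (1 + s) ^ 2 * ‖v‖ ^ 2 := by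
    intro r hr hrs
    rw [norm_pow, ← mul_pow]
    have : ‖v.1 + r * v.2‖ ≤ (1 + s) * ‖v‖ := by
      refine (norm_add_le _ _).trans ?_
      rw [norm_mul, Complex.norm_real, Real.norm_of_nonneg hr.le]
      nlinarith [mul_le_mul hrs h2 (norm_nonneg _) hs.le]
    gcongr
  have hpos : 0 ≤ (1 + s) ^ 2 * ‖v‖ ^ 2 := by positivity
  rw [Prod.norm_def]
  refine max_le ?_ ?_
  · simp only [pottsStep]
    rw [norm_mul]
    nlinarith [mul_le_mul hκ (key s hs le_rfl) (norm_nonneg _) hM]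
  · simp only [pottsStep]
    nlinarith [key P hP hsP.le]

theorem norm_sq_le_pottsStep {s P m : ℝ} (hP : 0 < P) (hsP : P < s) {κ : ℂ} (hm : 0 < m)
    (hκ : m ≤ ‖κ‖) (v : ℂ × ℂ) :
    ‖v‖ ^ 2 ≤ 2 * (1 / m + 1) * ((1 + s) / (s - P)) ^ 2 * ‖pottsStep s P κ v‖ := by
  have hs : 0 < s := hP.trans hsP
  have hd : 0 < s - P := sub_pos.2 hsP
  set S := ‖pottsStep s P κ v‖ with hS
  set p := v.1 + s * v.2 with hp
  set r := v.1 + P * v.2 with hr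
  have h1 : ‖p‖ ^ 2 ≤ 1 / m * S := by
    have h : ‖κ * p ^ 2‖ ≤ S := norm_fst_le (pottsStep s P κ v)
    rw [norm_mul, norm_pow] at h
    rw [div_mul_eq_mul_div, le_div_iff₀ hm, one_mul]
    nlinarith [mul_le_mul_of_nonneg_right hκ (sq_nonneg ‖p‖)]
  have h2 : ‖r‖ ^ 2 ≤ S := by
    have h : ‖r ^ 2‖ ≤ S := norm_snd_le (pottsStep s P κ v)
    rwa [norm_pow] at h
  have hdC : ‖(s : ℂ) - P‖ = s - P := by
    rw [← Complex.ofReal_sub, Complex.norm_real, Real.norm_of_nonneg hd.le]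
  have h3 : ‖v.1‖ * (s - P) ≤ (1 + s) * (‖p‖ + ‖r‖) := by
    rw [← hdC, ← norm_mul, show v.1 * ((s : ℂ) - P) = s * r - P * p by rw [hp, hr]; ring]
    refine (norm_sub_le _ _).trans ?_
    rw [norm_mul, norm_mul, Complex.norm_real, Complex.norm_real, Real.norm_of_nonneg hs.le,
      Real.norm_of_nonneg hP.le]
    nlinarith [norm_nonneg p, norm_nonneg r]
  have h4 : ‖v.2‖ * (s - P) ≤ (1 + s) * (‖p‖ + ‖r‖) := by
    rw [← hdC, ← norm_mul, show v.2 * ((s : ℂ) - P) = p - r by rw [hp, hr]; ring]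
    refine (norm_sub_le _ _).trans ?_
    nlinarith [norm_nonneg p, norm_nonneg r]
  have h5 : ‖v‖ ≤ (1 + s) / (s - P) * (‖p‖ + ‖r‖) := by
    rw [div_mul_eq_mul_div, le_div_iff₀ hd, Prod.norm_def]
    rcases max_cases ‖v.1‖ ‖v.2‖ with ⟨h, -⟩ | ⟨h, -⟩ <;> rw [h] <;> assumption
  calc ‖v‖ ^ 2 ≤ ((1 + s) / (s - P) * (‖p‖ + ‖r‖)) ^ 2 := by gcongr
    _ = ((1 + s) / (s - P)) ^ 2 * (‖p‖ + ‖r‖) ^ 2 := mul_pow _ _ _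
    _ ≤ ((1 + s) / (s - P)) ^ 2 * (2 * (1 / m + 1) * S) := by
        gcongr
        nlinarith [sq_nonneg (‖p‖ - ‖r‖)]
    _ = _ := by ring

/-- If the linear form `v ↦ v.1 + τ v.2` is small at `v`, then it is not small at the image
of `v`. -/
theorem exists_norm_le_or_norm_pottsStep_le {s P τ M d₀ : ℝ} (hP : 0 < P) (hsP : P < s)
    (hτ : 0 < τ) (hM : 0 ≤ M) (hd₀ : 0 < d₀) :
    ∃ C, 1 ≤ C ∧ ∀ κ : ℂ, ‖κ‖ ≤ M → d₀ ≤ ‖κ * (s - τ) ^ 2 + τ * (P - τ) ^ 2‖ → ∀ v : ℂ × ℂ,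
      ‖v‖ ≤ C * ‖v.1 + τ * v.2‖ ∨
      ‖pottsStep s P κ v‖ ≤ C * ‖(pottsStep s P κ v).1 + τ * (pottsStep s P κ v).2‖ := by
  have hs : 0 < s := hP.trans hsP
  set L := M * (1 + τ + 2 * (s + τ)) + τ * (1 + τ + 2 * (P + τ)) with hL
  have hL0 : 0 ≤ L := by positivity
  set δ := min (1 / 2) (d₀ / (8 * (1 + τ) ^ 2 * (L + 1))) with hδ
  have hδ0 : 0 < δ := by positivity
  have hδ1 : δ ≤ 1 / 2 := min_le_left _ _
  have hδ2 : δ * L ≤ d₀ / (8 * (1 + τ) ^ 2) := by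
    have h : δ ≤ d₀ / (8 * (1 + τ) ^ 2 * (L + 1)) := min_le_right _ _
    calc δ * L ≤ δ * (L + 1) := by nlinarith
      _ ≤ d₀ / (8 * (1 + τ) ^ 2 * (L + 1)) * (L + 1) := by gcongr
      _ = d₀ / (8 * (1 + τ) ^ 2) := by field_simp
  set η := d₀ / (8 * (1 + τ) ^ 2) with hη
  have hη0 : 0 < η := by positivity
  set C₀ := (M + 1) * (1 + s) ^ 2 with hC₀
  refine ⟨max 1 (max (1 / δ) (C₀ / η)), le_max_left _ _, fun κ hκ hdκ v => ?_⟩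
  set D := v.1 + τ * v.2 with hD
  rcases le_or_gt (δ * ‖v‖) ‖D‖ with h | h
  · left
    calc ‖v‖ = 1 / δ * (δ * ‖v‖) := by field_simp
      _ ≤ 1 / δ * ‖D‖ := by gcongr
      _ ≤ _ := by gcongr; exact (le_max_left _ _).trans (le_max_right _ _)
  · right
    set N := ‖v‖ with hN
    have hN0 : 0 ≤ N := norm_nonneg v
    have hB : ‖v.2‖ ≤ N := norm_snd_le v
    have hlow : N / (2 * (1 + τ)) ≤ ‖v.2‖ := by
      have h1 : ‖v.1‖ ≤ ‖D‖ + τ * ‖v.2‖ := by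
        have : ‖v.1‖ = ‖D - τ * v.2‖ := by rw [hD]; ring_nf
        rw [this]
        refine (norm_sub_le _ _).trans ?_
        rw [norm_mul, Complex.norm_real, Real.norm_of_nonneg hτ.le]
      have h2 : N ≤ ‖D‖ + (1 + τ) * ‖v.2‖ := by
        rw [hN, Prod.norm_def]
        refine max_le ?_ ?_ <;> nlinarith [norm_nonneg D, norm_nonneg v.2]
      rw [div_le_iff₀ (by positivity)]
      nlinarith
    set w := pottsStep s P κ v with hw
    have hid : w.1 + τ * w.2 = D * (κ * (D + 2 * (s - τ) * v.2) + τ * (D + 2 * (P - τ) * v.2)) +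
        v.2 ^ 2 * (κ * (s - τ) ^ 2 + τ * (P - τ) ^ 2) := by
      rw [hw, hD]; simp only [pottsStep]; ring
    have hlin : ∀ r : ℝ, 0 < r → ‖D + 2 * (r - τ) * v.2‖ ≤ (1 + τ + 2 * (r + τ)) * N := by
      intro r hr
      refine (norm_add_le _ _).trans ?_
      have h1 : ‖(2 : ℂ) * (r - τ)‖ ≤ 2 * (r + τ) := by
        rw [norm_mul]
        have := norm_sub_le (r : ℂ) τ
        rw [Complex.norm_real, Complex.norm_real, Real.norm_of_nonneg hτ.le,
          Real.norm_of_nonneg hr.le] at this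
        norm_num
        linarith
      rw [norm_mul]
      nlinarith [mul_le_mul h1 hB (norm_nonneg _) (by positivity)]
    have hE : ‖κ * (D + 2 * (s - τ) * v.2) + τ * (D + 2 * (P - τ) * v.2)‖ ≤ L * N := by
      refine (norm_add_le _ _).trans ?_
      rw [norm_mul, norm_mul, Complex.norm_real, Real.norm_of_nonneg hτ.le]
      have h1 := mul_le_mul hκ (hlin s hs) (norm_nonneg _) hM
      have h2 := mul_le_mul_of_nonneg_left (hlin P hP) hτ.le
      rw [hL]; linarith
    have hmain : η * N ^ 2 ≤ ‖w.1 + τ * w.2‖ := by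
      have h1 : ‖v.2 ^ 2 * (κ * (s - τ) ^ 2 + τ * (P - τ) ^ 2)‖ ≤ ‖w.1 + τ * w.2‖ +
          ‖D * (κ * (D + 2 * (s - τ) * v.2) + τ * (D + 2 * (P - τ) * v.2))‖ := by
        rw [hid, add_comm (D * _)]
        exact norm_le_add_norm_add _ _
      have h2 : 2 * η * N ^ 2 ≤ ‖v.2 ^ 2 * (κ * (s - τ) ^ 2 + τ * (P - τ) ^ 2)‖ := by
        rw [norm_mul, norm_pow]
        calc 2 * η * N ^ 2 = (N / (2 * (1 + τ))) ^ 2 * d₀ := by rw [hη]; field_simp; ring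
          _ ≤ _ := by gcongr
      have h3 : ‖D * (κ * (D + 2 * (s - τ) * v.2) + τ * (D + 2 * (P - τ) * v.2))‖ ≤ η * N ^ 2 := by
        rw [norm_mul]
        calc _ ≤ (δ * N) * (L * N) := by gcongr
          _ = (δ * L) * N ^ 2 := by ring
          _ ≤ η * N ^ 2 := by gcongr
      linarith
    calc ‖w‖ ≤ C₀ * N ^ 2 := norm_pottsStep_le hP hsP hκ v
      _ = C₀ / η * (η * N ^ 2) := by field_simp
      _ ≤ C₀ / η * ‖w.1 + τ * w.2‖ := by gcongr
      _ ≤ _ := by gcongr; exact (le_max_right _ _).trans (le_max_right _ _)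

theorem pottsLift_ne_zero {s P c : ℝ} (hP : 0 < P) (hsP : P < s) {κ : ℂ} (hκ : κ ≠ 0) (n : ℕ) :
    pottsLift s P c κ n ≠ 0 := by
  induction n with
  | zero => simp [pottsLift_zero]
  | succ n ih =>
    intro h
    have := norm_sq_le_pottsStep hP hsP (norm_pos_iff.2 hκ) le_rfl (pottsLift s P c κ n)
    rw [← pottsLift_succ, h, norm_zero, mul_zero] at this
    have h2 := norm_pos_iff.2 ih
    nlinarith

theorem differentiable_pottsLift (s P c : ℂ) (n : ℕ) :
    Differentiable ℂ fun κ => pottsLift s P c κ n := by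
  induction n with
  | zero => exact differentiable_const _
  | succ n ih =>
    simp only [pottsLift_succ, pottsStep]
    exact (differentiable_id.mul ((ih.fst.add (ih.snd.const_mul s)).pow 2)).prodMk
      ((ih.fst.add (ih.snd.const_mul P)).pow 2)

theorem differentiableAt_pottsParam {s P y : ℂ} (hy : y + s ≠ 0) :
    DifferentiableAt ℂ (pottsParam s P) y := by
  unfold pottsParam
  exact differentiableAt_id.mul
    (((differentiableAt_id.add_const P).div (differentiableAt_id.add_const s) hy).pow 2)

theorem exists_pottsLift_ofReal {s P c κ : ℝ} (hs : 0 < s) (hP : 0 < P) (hc : 0 < c) (hκ : 0 < κ)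
    (n : ℕ) : ∃ A B : ℝ, 0 < A ∧ 0 < B ∧ pottsLift s P c κ n = ((A : ℂ), (B : ℂ)) ∧
      A = (pottsMap s P κ)^[n] c * B := by
  induction n with
  | zero => exact ⟨c, 1, hc, one_pos, by simp [pottsLift_zero], by simp⟩
  | succ n ih =>
    obtain ⟨A, B, hA, hB, h, hAB⟩ := ih
    refine ⟨κ * (A + s * B) ^ 2, (A + P * B) ^ 2, by positivity, by positivity, ?_, ?_⟩
    · rw [pottsLift_succ, h]; simp [pottsStep]
    · rw [Function.iterate_succ_apply']
      have hu := iterate_pottsMap_pos hs hP hκ hc n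
      generalize (pottsMap s P κ)^[n] c = u at *
      subst hAB
      simp only [pottsMap]
      field_simp

theorem div_pottsStep {s P κ : ℂ} {v : ℂ × ℂ} (hv : v.2 ≠ 0) :
    (pottsStep s P κ v).1 / (pottsStep s P κ v).2 = pottsMap s P κ (v.1 / v.2) := by
  have h : ∀ r : ℂ, v.1 / v.2 + r = (v.1 + r * v.2) / v.2 := fun r => by field_simp
  simp only [pottsStep, pottsMap]
  rw [h, h, div_div_div_cancel_right₀ hv, div_pow, mul_div_assoc]

theorem exists_pottsLift_estimates {s P τ y₀ : ℝ} (c : ℝ) (hP : 0 < P) (hsP : P < s) (hτ : 0 < τ)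
    (hy₀ : 0 < y₀) :
    ∃ R, 0 < R ∧ R < y₀ ∧ ∃ C, 1 ≤ C ∧ ∀ y ∈ ball (y₀ : ℂ) R, pottsParam (s : ℂ) P y ≠ 0 ∧
      ∀ n, ‖pottsLift s P c (pottsParam (s : ℂ) P y) (n + 1)‖ ≤
          C * ‖pottsLift s P c (pottsParam (s : ℂ) P y) n‖ ^ 2 ∧
        ‖pottsLift s P c (pottsParam (s : ℂ) P y) n‖ ^ 2 ≤
          C * ‖pottsLift s P c (pottsParam (s : ℂ) P y) (n + 1)‖ ∧
        (‖pottsLift s P c (pottsParam (s : ℂ) P y) n‖ ≤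
            C * ‖(pottsLift s P c (pottsParam (s : ℂ) P y) n).1 +
              τ * (pottsLift s P c (pottsParam (s : ℂ) P y) n).2‖ ∨
          ‖pottsLift s P c (pottsParam (s : ℂ) P y) (n + 1)‖ ≤
            C * ‖(pottsLift s P c (pottsParam (s : ℂ) P y) (n + 1)).1 +
              τ * (pottsLift s P c (pottsParam (s : ℂ) P y) (n + 1)).2‖) := by
  have hs : 0 < s := hP.trans hsP
  set κ₀ := pottsParam s P y₀ with hκ₀
  have hκ₀pos : 0 < κ₀ := pottsParam_pos hs hP hy₀
  have hκ₀C : pottsParam (s : ℂ) P y₀ = (κ₀ : ℂ) := (ofReal_pottsParam s P y₀).symm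
  set d := fun κ : ℂ => κ * (s - τ) ^ 2 + τ * (P - τ) ^ 2 with hd
  have hd₀ : 0 < ‖d κ₀‖ := by
    have h1 : d κ₀ = ((κ₀ * (s - τ) ^ 2 + τ * (P - τ) ^ 2 : ℝ) : ℂ) := by simp [hd]
    have h2 : 0 < κ₀ * (s - τ) ^ 2 + τ * (P - τ) ^ 2 := by
      rcases eq_or_ne s τ with h | h
      · have : P - τ ≠ 0 := by rw [← h]; linarith
        positivity
      · have : s - τ ≠ 0 := sub_ne_zero.2 h
        positivity
    rw [h1, Complex.norm_real]
    exact norm_pos_iff.2 h2.ne'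
  have hcont : ContinuousAt (pottsParam (s : ℂ) P) y₀ :=
    (differentiableAt_pottsParam (by exact_mod_cast (add_pos hy₀ hs).ne')).continuousAt
  have hdcont : Continuous d := by fun_prop
  have hn0 : ‖pottsParam (s : ℂ) P y₀‖ = κ₀ := by
    rw [hκ₀C, Complex.norm_real, Real.norm_of_nonneg hκ₀pos.le]
  have e1 : ∀ᶠ y in 𝓝 (y₀ : ℂ), κ₀ / 2 < ‖pottsParam (s : ℂ) P y‖ :=
    hcont.norm.eventually_const_lt (by simp only [hn0]; linarith)
  have e2 : ∀ᶠ y in 𝓝 (y₀ : ℂ), ‖pottsParam (s : ℂ) P y‖ < 2 * κ₀ :=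
    hcont.norm.eventually_lt_const (by simp only [hn0]; linarith)
  have e3 : ∀ᶠ y in 𝓝 (y₀ : ℂ), ‖d κ₀‖ / 2 < ‖d (pottsParam (s : ℂ) P y)‖ :=
    ((hdcont.continuousAt.comp hcont).norm).eventually_const_lt
      (by simp only [Function.comp_apply]; rw [hκ₀C]; linarith)
  obtain ⟨R, hR, hball⟩ := Metric.eventually_nhds_iff_ball.1 (e1.and (e2.and e3))
  obtain ⟨C, hC, hCd⟩ := exists_norm_le_or_norm_pottsStep_le hP hsP hτ
    (by positivity : 0 ≤ 2 * κ₀) (half_pos hd₀)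
  refine ⟨min R (y₀ / 2), by positivity, (min_le_right _ _).trans_lt (by linarith),
    max C (max ((2 * κ₀ + 1) * (1 + s) ^ 2) (2 * (1 / (κ₀ / 2) + 1) * ((1 + s) / (s - P)) ^ 2)),
    hC.trans (le_max_left _ _), fun y hy => ?_⟩
  obtain ⟨h1, h2, h3⟩ := hball y (ball_subset_ball (min_le_left _ _) hy)
  generalize pottsParam (s : ℂ) P y = κ at *
  refine ⟨norm_pos_iff.1 ((half_pos hκ₀pos).trans h1), fun n => ?_⟩
  rw [pottsLift_succ]
  refine ⟨(norm_pottsStep_le hP hsP h2.le _).trans ?_,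
    (norm_sq_le_pottsStep hP hsP (half_pos hκ₀pos) h1.le _).trans ?_,
    (hCd κ h2.le h3.le (pottsLift s P c κ n)).imp (fun h => h.trans ?_) fun h => h.trans ?_⟩
  · gcongr; exact (le_max_left _ _).trans (le_max_right _ _)
  · gcongr; exact (le_max_right _ _).trans (le_max_right _ _)
  · gcongr; exact le_max_left _ _
  · gcongr; exact le_max_left _ _

/-- If at each point of a nonempty open set one of countably many holomorphic functions vanishes,
then one of them vanishes identically. -/
theorem exists_eqOn_zero_of_forall_exists_eq_zero {c : ℂ} {R : ℝ} {U : Set ℂ} {X : ℕ → ℂ → ℂ}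
    (hX : ∀ n, DifferentiableOn ℂ (X n) (ball c R)) (hU : IsOpen U) (hne : U.Nonempty)
    (hUR : U ⊆ ball c R) (h : ∀ y ∈ U, ∃ n, X n y = 0) : ∃ n, EqOn (X n) 0 (ball c R) := by
  obtain ⟨p, hp⟩ := hne
  obtain ⟨r, hr, hrU⟩ := Metric.nhds_basis_closedBall.mem_iff.1 (hU.mem_nhds hp)
  obtain ⟨n, hn⟩ : ∃ n, {y ∈ closedBall p r | X n y = 0}.Infinite := by
    by_contra! hfin
    have hc : (closedBall p r).Countable := by
      refine (countable_iUnion fun n => (hfin n).countable).mono fun y hy => ?_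
      obtain ⟨n, hn⟩ := h y (hrU hy)
      exact mem_iUnion.2 ⟨n, hy, hn⟩
    obtain ⟨y, hy, hy'⟩ := (hc.dense_compl ℝ).inter_open_nonempty _ isOpen_ball
      ⟨p, mem_ball_self hr⟩
    exact hy' (ball_subset_closedBall hy)
  obtain ⟨x, hx, hacc⟩ := hn.exists_accPt_of_subset_isCompact (isCompact_closedBall p r)
    fun y hy => hy.1
  refine ⟨n, ((hX n).analyticOnNhd isOpen_ball).eqOn_zero_of_preconnected_of_frequently_eq_zero
    (convex_ball c R).isPreconnected (hUR (hrU hx)) ?_⟩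
  exact (accPt_iff_frequently_nhdsNE.1 hacc).mono fun y hy => hy.2

theorem exists_norm_mul_lt_near {s P y₀ R : ℝ} (hs : 0 < s) (hP : 0 < P) (hy₀ : 0 < y₀)
    (hR : 0 < R) :
    ∃ y ∈ ball (y₀ : ℂ) R, ‖y‖ = y₀ ∧ ‖(y + s) * (y + P)‖ < (y₀ + s) * (y₀ + P) := by
  have hcont : Tendsto (fun θ : ℝ => (y₀ : ℂ) * Complex.exp (θ * Complex.I)) (𝓝[>] 0)
      (𝓝 (y₀ : ℂ)) := by
    have h : Continuous fun θ : ℝ => (y₀ : ℂ) * Complex.exp (θ * Complex.I) := by fun_prop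
    have h0 := h.tendsto 0
    simp only [Complex.ofReal_zero, zero_mul, Complex.exp_zero, mul_one] at h0
    exact h0.mono_left nhdsWithin_le_nhds
  obtain ⟨θ, hθR, hθ⟩ := ((hcont.eventually (ball_mem_nhds _ hR)).and
    (Ioo_mem_nhdsGT Real.pi_pos)).exists
  have hcos : Real.cos θ < 1 := by
    have := Real.cos_lt_cos_of_nonneg_of_le_pi le_rfl hθ.2.le hθ.1
    rwa [Real.cos_zero] at this
  set y := (y₀ : ℂ) * Complex.exp (θ * Complex.I) with hy
  have hn : ‖y‖ = y₀ := by
    rw [hy, norm_mul, Complex.norm_exp_ofReal_mul_I, mul_one, Complex.norm_real,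
      Real.norm_of_nonneg hy₀.le]
  have hre : y.re < y₀ := by
    rw [hy, Complex.re_ofReal_mul, Complex.exp_ofReal_mul_I_re]
    nlinarith
  have key : ∀ r : ℝ, 0 < r → ‖y + r‖ < y₀ + r := by
    intro r hr
    refine lt_of_pow_lt_pow_left₀ 2 (by positivity) ?_
    have h1 : ‖y + r‖ ^ 2 = ‖y‖ ^ 2 + 2 * r * y.re + r ^ 2 := by
      rw [Complex.sq_norm, Complex.sq_norm, Complex.normSq_apply, Complex.normSq_apply]
      simp only [Complex.add_re, Complex.ofReal_re, Complex.add_im, Complex.ofReal_im]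
      ring
    rw [h1, hn]
    nlinarith
  refine ⟨y, hθR, hn, ?_⟩
  rw [norm_mul]
  exact mul_lt_mul'' (key s hs) (key P hP) (norm_nonneg _) (norm_nonneg _)

theorem log_le_log_add_of_le_mul {a b C : ℝ} (ha : 0 < a) (hC : 1 ≤ C) (h : a ≤ C * b) :
    Real.log a ≤ Real.log b + C := by
  have hC0 : 0 < C := by linarith
  have hb : 0 < b := by
    by_contra! hb
    nlinarith
  calc Real.log a ≤ Real.log (C * b) := Real.log_le_log ha h
    _ = Real.log C + Real.log b := Real.log_mul hC0.ne' hb.ne'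
    _ ≤ _ := by linarith [Real.log_le_self hC0.le]

theorem frequently_exists_pottsLift_zero {s P τ c y₀ : ℝ} (hP : 0 < P) (hsP : P < s) (hτ : 0 < τ)
    (hc : 0 < c) (hy₀ : 0 < y₀) (hroot : y₀ ^ 2 - (s - 3 * P) * y₀ + s * P = 0) :
    ∃ᶠ y in 𝓝 (y₀ : ℂ), ∃ n, (pottsLift s P c (pottsParam (s : ℂ) P y) n).1 +
      τ * (pottsLift s P c (pottsParam (s : ℂ) P y) n).2 = 0 := by
  have hs : 0 < s := hP.trans hsP
  intro hev
  simp only [not_exists] at hev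
  obtain ⟨R₁, hR₁, hR₁0⟩ := Metric.eventually_nhds_iff_ball.1 hev
  obtain ⟨R₂, hR₂, hR₂y, C₁, hC₁, hest⟩ := exists_pottsLift_estimates c hP hsP hτ hy₀
  obtain ⟨R, hR, hRR₁, hRR₂⟩ : ∃ R, 0 < R ∧ R ≤ R₁ ∧ R ≤ R₂ :=
    ⟨min R₁ R₂, lt_min hR₁ hR₂, min_le_left _ _, min_le_right _ _⟩
  set v : ℕ → ℂ → ℂ × ℂ := fun n y => pottsLift s P c (pottsParam (s : ℂ) P y) n with hv
  set ν : ℕ → ℂ → ℝ := fun n y => Real.log ‖v n y‖ with hν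
  set K := C₁ + (1 + τ) + (1 + 1 / τ) + ‖((c : ℂ), (1 : ℂ))‖ + (1 + 2 * y₀) with hK
  have hτ' : 0 < 1 / τ := by positivity
  have hK₀ := norm_nonneg ((c : ℂ), (1 : ℂ))
  have hK1 : 1 ≤ K := by linarith
  have hre : ∀ y ∈ ball (y₀ : ℂ) R, 0 < y.re := by
    intro y hy
    have h1 : |(y - y₀).re| < R :=
      (Complex.abs_re_le_norm _).trans_lt (by simpa [dist_eq_norm] using hy)
    rw [Complex.sub_re, Complex.ofReal_re] at h1
    linarith [(abs_lt.1 h1).1]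
  have hne : ∀ r : ℝ, 0 < r → ∀ y ∈ ball (y₀ : ℂ) R, y + r ≠ 0 := by
    intro r hr y hy h
    have h1 := congrArg Complex.re h
    simp only [Complex.add_re, Complex.ofReal_re, Complex.zero_re] at h1
    linarith [hre y hy]
  have hnorm : ∀ y ∈ ball (y₀ : ℂ) R, ‖y‖ ≤ 2 * y₀ := by
    intro y hy
    have h1 : ‖y - y₀‖ < R := by simpa [dist_eq_norm] using hy
    have h2 := norm_le_norm_sub_add y (y₀ : ℂ)
    rw [Complex.norm_real, Real.norm_of_nonneg hy₀.le] at h2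
    linarith
  have hest' : ∀ y ∈ ball (y₀ : ℂ) R, _ := fun y hy => hest y (ball_subset_ball hRR₂ hy)
  have hpos : ∀ y ∈ ball (y₀ : ℂ) R, ∀ n, 0 < ‖v n y‖ := fun y hy n =>
    norm_pos_iff.2 (pottsLift_ne_zero hP hsP (hest' y hy).1 n)
  have hlogK : ∀ {a b C : ℝ}, 0 < a → C ≤ K → 0 ≤ b → a ≤ C * b → Real.log a ≤ Real.log b + K :=
    fun ha hCK hb h => log_le_log_add_of_le_mul ha hK1 (h.trans (by gcongr))
  have hvdiff : ∀ n, DifferentiableOn ℂ (v n) (ball (y₀ : ℂ) R) := fun n y hy =>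
    ((differentiable_pottsLift s P c n _).comp y
      (differentiableAt_pottsParam (hne s hs y hy))).differentiableWithinAt
  have hfst : ∀ (n y), ‖(v n y).1‖ ≤ ‖v n y‖ := fun n y => norm_fst_le _
  have hsnd : ∀ (n y), ‖(v n y).2‖ ≤ ‖v n y‖ := fun n y => norm_snd_le _
  have hreal : ∀ n (x : ℝ), (x : ℂ) ∈ ball (y₀ : ℂ) R → 0 < x ∧ ∃ A B : ℝ, 0 < A ∧ 0 < B ∧
      v n x = ((A : ℂ), (B : ℂ)) ∧ A = (pottsMap s P (pottsParam s P x))^[n] c * B := by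
    intro n x hx
    have hx0 : 0 < x := by simpa using hre x hx
    have hκ := pottsParam_pos hs hP hx0
    refine ⟨hx0, ?_⟩
    simp only [hv]
    rw [← ofReal_pottsParam]
    exact exists_pottsLift_ofReal hs hP hc hκ n
  obtain ⟨E, hE, hEν⟩ := exists_holomorphic_growth_rate (c := y₀) (R := R) (K := K)
    (D := fun n y => (v n y).1 + τ * (v n y).2) (ν := ν) hR (by linarith)
    (fun n => (hvdiff n).fst.add ((hvdiff n).snd.const_mul _))
    (fun n y hy => hR₁0 y (ball_subset_ball hRR₁ hy) n)
    (by
      intro n x hx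
      obtain ⟨-, A, B, hA, hB, h, -⟩ := hreal n x hx
      exact ⟨A + τ * B, by positivity, by simp [h]⟩)
    (by
      intro y hy
      simp only [hν, hv, pottsLift_zero]
      exact (Real.log_le_self hK₀).trans (by linarith))
    (by
      intro n y hy
      obtain ⟨-, h⟩ := hest' y hy
      have h1 := hlogK (hpos y hy (n + 1)) (by linarith) (by positivity) (h n).1
      have h2 := hlogK (pow_pos (hpos y hy n) 2) (by linarith) (norm_nonneg _) (h n).2.1
      rw [Real.log_pow, Nat.cast_ofNat] at h1 h2
      rw [abs_le]
      constructor <;> simp only [hν, hv] <;> linarith)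
    (by
      intro n y hy
      refine hlogK (norm_pos_iff.2 (hR₁0 y (ball_subset_ball hRR₁ hy) n))
        (by linarith : 1 + τ ≤ K) (norm_nonneg _) ?_
      refine (norm_add_le _ _).trans ?_
      rw [norm_mul, Complex.norm_real, Real.norm_of_nonneg hτ.le]
      nlinarith [hfst n y, hsnd n y])
    (by
      intro n y hy
      refine ((hest' y hy).2 n).2.2.imp (fun h => ?_) fun h => ?_
      · exact hlogK (hpos y hy n) (by linarith) (norm_nonneg _) h
      · exact hlogK (hpos y hy (n + 1)) (by linarith) (norm_nonneg _) h)
    (by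
      intro n x hx
      refine hlogK (hpos x hx n) (by linarith : 1 + 1 / τ ≤ K) (norm_nonneg _) ?_
      obtain ⟨-, A, B, hA, hB, h, -⟩ := hreal n x hx
      have h1 : ‖(v n x).1 + τ * (v n x).2‖ = A + τ * B := by
        rw [h]
        simp only
        rw [← Complex.ofReal_mul, ← Complex.ofReal_add, Complex.norm_real,
          Real.norm_of_nonneg (by positivity)]
      rw [h1, h, Prod.norm_def]
      simp only [Complex.norm_real, Real.norm_of_nonneg hA.le, Real.norm_of_nonneg hB.le]
      have h2 : (1 + 1 / τ) * (A + τ * B) = A + τ * B + A / τ + B := by field_simp; ring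
      have h3 : 0 < A / τ := by positivity
      have h4 : 0 < τ * B := by positivity
      rw [h2]
      exact max_le (by linarith) (by linarith))
  set X : ℕ → ℂ → ℂ := fun n y => (v n y).1 - y * (v n y).2 with hX
  have hsub4 : ball (y₀ : ℂ) (R / 4) ⊆ ball (y₀ : ℂ) R := ball_subset_ball (by linarith)
  have hsub16 : ball (y₀ : ℂ) (R / 4 / 4) ⊆ ball (y₀ : ℂ) R := ball_subset_ball (by linarith)
  have hXdiff : ∀ n, DifferentiableOn ℂ (X n) (ball (y₀ : ℂ) R) := fun n =>
    (hvdiff n).fst.sub (differentiableOn_id.mul (hvdiff n).snd)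
  have hexp : ∀ y ∈ ball (y₀ : ℂ) R, ∀ n, Real.exp (ν n y) = ‖v n y‖ := fun y hy n =>
    Real.exp_log (hpos y hy n)
  have hside : ∃ᶠ x in 𝓝[≠] (y₀ : ℂ), ∃ x' : ℝ, (x' : ℂ) = x ∧ 0 < x' ∧
      ((y₀ ^ 2 ≤ s * P ∧ x' ≤ y₀) ∨ (s * P ≤ y₀ ^ 2 ∧ y₀ ≤ x')) := by
    have hev0 : ∀ᶠ x in 𝓝 y₀, 0 < x := lt_mem_nhds hy₀
    have hmap : Tendsto (fun x : ℝ => (x : ℂ)) (𝓝[≠] y₀) (𝓝[≠] (y₀ : ℂ)) :=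
      (Complex.continuous_ofReal.continuousAt).continuousWithinAt.tendsto_nhdsWithin
        fun x hx => by simpa using hx
    rcases le_total (y₀ ^ 2) (s * P) with h | h
    · refine (hmap.mono_left (nhdsLT_le_nhdsNE y₀)).frequently (Eventually.frequently ?_)
      filter_upwards [nhdsWithin_le_nhds hev0, self_mem_nhdsWithin] with x hx hx'
      exact ⟨x, rfl, hx, Or.inl ⟨h, le_of_lt hx'⟩⟩
    · refine (hmap.mono_left (nhdsGT_le_nhdsNE y₀)).frequently (Eventually.frequently ?_)
      filter_upwards [nhdsWithin_le_nhds hev0, self_mem_nhdsWithin] with x hx hx'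
      exact ⟨x, rfl, hx, Or.inr ⟨h, le_of_lt hx'⟩⟩
  have hlim : ∀ y ∈ ball (y₀ : ℂ) (R / 4 / 4),
      Tendsto (fun n => ‖X n y‖ / Real.exp (ν n y)) atTop (𝓝 0) := by
    refine tendsto_div_exp_growth_zero (K := K) (by positivity) hE hEν
      (fun n => (hXdiff n).mono hsub4) ?_ ?_
    · intro n y hy
      rw [hexp y (hsub4 hy)]
      refine (norm_sub_le _ _).trans ?_
      rw [norm_mul]
      have h1 := hnorm y (hsub4 hy)
      nlinarith [hfst n y, hsnd n y, norm_nonneg y, norm_nonneg (v n y), norm_nonneg (v n y).2,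
        mul_le_mul h1 (hsnd n y) (norm_nonneg _) (by positivity)]
    · refine (hside.and_eventually (nhdsWithin_le_nhds (ball_mem_nhds (y₀ : ℂ) hR))).mono ?_
      rintro _ ⟨⟨x, rfl, hx0, hxs⟩, hxR⟩
      have hconv := tendsto_iterates_fixed_point hP hsP hy₀ hroot hx0 hc hxs
      have hconv' := (tendsto_iff_norm_sub_tendsto_zero.1 hconv)
      refine squeeze_zero (fun n => by positivity) (fun n => ?_) hconv'
      obtain ⟨-, A, B, hA, hB, h, hAB⟩ := hreal n x hxR
      rw [hexp _ hxR, div_le_iff₀ (hpos _ hxR n)]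
      have h1 : X n x = (((pottsMap s P (pottsParam s P x))^[n] c - x) * B : ℝ) := by
        simp only [hX, h]
        rw [← Complex.ofReal_mul, ← Complex.ofReal_sub]
        congr 1
        linear_combination hAB
      rw [h1, Complex.norm_real, norm_mul]
      gcongr
      rw [h]
      simp
  have hratio : ∀ y ∈ ball (y₀ : ℂ) (R / 4 / 4), (∀ᶠ n in atTop, (v n y).2 ≠ 0) ∧
      Tendsto (fun n => (v n y).1 / (v n y).2) atTop (𝓝 y) := by
    intro y hy
    have hl := hlim y hy
    simp only [hexp y (hsub16 hy)] at hl
    have hsmall : ∀ᶠ n in atTop, ‖v n y‖ ≤ 2 * (1 + ‖y‖) * ‖(v n y).2‖ := by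
      filter_upwards [hl.eventually_lt_const (by norm_num : (0 : ℝ) < 1 / 2)] with n hn
      rw [div_lt_iff₀ (hpos y (hsub16 hy) n)] at hn
      have h1 : ‖(v n y).1‖ ≤ ‖X n y‖ + ‖y‖ * ‖(v n y).2‖ := by
        rw [← norm_mul]
        have : (v n y).1 = X n y + y * (v n y).2 := by simp only [hX]; ring
        nth_rw 1 [this]
        exact norm_add_le _ _
      have h2 : ‖v n y‖ ≤ ‖X n y‖ + (1 + ‖y‖) * ‖(v n y).2‖ := by
        rw [Prod.norm_def]
        refine max_le ?_ ?_ <;>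
          nlinarith [norm_nonneg (X n y), norm_nonneg y, norm_nonneg (v n y).2,
            mul_nonneg (norm_nonneg y) (norm_nonneg (v n y).2)]
      linarith
    have hne0 : ∀ᶠ n in atTop, (v n y).2 ≠ 0 := by
      filter_upwards [hsmall] with n hn h0
      rw [h0, norm_zero, mul_zero] at hn
      linarith [hpos y (hsub16 hy) n]
    refine ⟨hne0, tendsto_iff_norm_sub_tendsto_zero.2 ?_⟩
    have hl2 := hl.const_mul (2 * (1 + ‖y‖))
    rw [mul_zero] at hl2
    refine squeeze_zero' (Eventually.of_forall fun n => norm_nonneg _) ?_ hl2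
    filter_upwards [hsmall, hne0] with n hn h0
    have h1 : (v n y).1 / (v n y).2 - y = X n y / (v n y).2 := by
      simp only [hX]; field_simp
    rw [h1, norm_div, ← mul_div_assoc, div_le_div_iff₀ (norm_pos_iff.2 h0) (hpos y (hsub16 hy) n)]
    nlinarith [norm_nonneg (X n y)]
  obtain ⟨y₁, hy₁R, hy₁n, hy₁⟩ := exists_norm_mul_lt_near (R := R / 4 / 4) hs hP hy₀ (by positivity)
  have hmult : (y₀ + s) * (y₀ + P) = 2 * (s - P) * y₀ := by linear_combination hroot
  set U : Set ℂ := ball (y₀ : ℂ) (R / 4 / 4) ∩ {y | ‖(y + s) * (y + P)‖ < 2 * (s - P) * ‖y‖} with hU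
  have hUopen : IsOpen U := isOpen_ball.inter (isOpen_lt (by fun_prop) (by fun_prop))
  obtain ⟨n, hn⟩ := exists_eqOn_zero_of_forall_exists_eq_zero
    (fun n => (hXdiff n).mono hsub16) hUopen
    ⟨y₁, hy₁R, by rwa [mem_ofPred_eq, hy₁n, ← hmult]⟩ inter_subset_left (by
      rintro y ⟨hyR, hylt⟩
      have hylt : ‖(y + s) * (y + P)‖ < 2 * (s - P) * ‖y‖ := hylt
      have hys := hne s hs y (hsub16 hyR)
      have hyP := hne P hP y (hsub16 hyR)
      have hy0 : y ≠ 0 := by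
        rintro rfl
        simpa using hre 0 (hsub16 hyR)
      obtain ⟨hne0, hl⟩ := hratio y hyR
      have hfix := pottsMap_pottsParam hys hyP
      have hderiv := hasDerivAt_pottsMap (κ := pottsParam (s : ℂ) P y) hys hyP
      rw [hfix] at hderiv
      obtain ⟨n, hn⟩ := exists_eq_of_tendsto_repelling hderiv hfix (by
          rw [norm_neg, norm_div, one_lt_div (norm_pos_iff.2 (mul_ne_zero hys hyP))]
          refine hylt.trans_eq ?_
          rw [norm_mul, norm_mul, ← Complex.ofReal_sub, Complex.norm_real,
            Real.norm_of_nonneg (sub_pos.2 hsP).le]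
          norm_num) (by
          filter_upwards [hne0] with n h0
          simp only [hv, pottsLift_succ]
          exact div_pottsStep h0) hl
      refine ⟨n, ?_⟩
      have h0 : (v n y).2 ≠ 0 := by
        intro h0
        rw [h0, div_zero] at hn
        exact hy0 hn.symm
      rw [div_eq_iff h0] at hn
      simp only [hX, hn, sub_self])
  have hfinal : ∀ x : ℝ, (x : ℂ) ∈ ball (y₀ : ℂ) (R / 4 / 4) → c = x := by
    intro x hx
    obtain ⟨hx0, A, B, hA, hB, h, hAB⟩ := hreal n x (hsub16 hx)
    have h1 : X n x = 0 := hn hx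
    simp only [hX, h] at h1
    have h2 : A = x * B := by exact_mod_cast sub_eq_zero.1 h1
    have h3 : (pottsMap s P (pottsParam s P x))^[n] c = x :=
      mul_right_cancel₀ hB.ne' (hAB.symm.trans h2)
    have h4 : pottsMap s P (pottsParam s P x) x = x :=
      pottsMap_pottsParam (by positivity) (by positivity)
    refine eq_of_iterate_pottsMap_eq hP hsP (pottsParam_pos hs hP hx0) n hc hx0 ?_
    rw [h3, Function.iterate_fixed h4]
  have hc1 := hfinal y₀ (mem_ball_self (by positivity))
  have hc2 := hfinal (y₀ + R / 32) (by
    rw [mem_ball, dist_eq_norm, Complex.ofReal_add, add_sub_cancel_left, Complex.norm_real,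
      Real.norm_of_nonneg (by positivity)]
    linarith)
  linarith

theorem continuousAt_pottsMap_uncurry {s P κ u : ℂ} (hu : u + P ≠ 0) :
    ContinuousAt (fun p : ℂ × ℂ => pottsMap s P p.1 p.2) (κ, u) := by
  unfold pottsMap
  exact continuousAt_fst.mul (((continuousAt_snd.add continuousAt_const).div
    (continuousAt_snd.add continuousAt_const) hu).pow 2)

/-- A ball around an attracting fixed point of the second iterate is trapping for all nearby
parameters. -/
theorem exists_trapping_ball {s P τ κ₀ a : ℝ} (hP : 0 < P) (hsP : P < s) (hτ : 0 < τ)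
    (hκ₀ : 0 < κ₀) (ha : 0 < a) (hcycle : pottsMap s P κ₀ (pottsMap s P κ₀ a) = a)
    (hmult : 4 * (s - P) ^ 2 * (a * pottsMap s P κ₀ a) <
      (a + s) * (a + P) * ((pottsMap s P κ₀ a + s) * (pottsMap s P κ₀ a + P))) :
    ∃ r, 0 < r ∧ ∀ᶠ κ in 𝓝 (κ₀ : ℂ), ∀ u ∈ closedBall (a : ℂ) r,
      (u + P ≠ 0 ∧ u + τ ≠ 0 ∧ pottsMap (s : ℂ) P κ u + P ≠ 0 ∧ pottsMap (s : ℂ) P κ u + τ ≠ 0) ∧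
        pottsMap (s : ℂ) P κ (pottsMap (s : ℂ) P κ u) ∈ closedBall (a : ℂ) r := by
  have hs : 0 < s := hP.trans hsP
  have hb := pottsMap_pos hs hP hκ₀ ha
  set b := pottsMap s P κ₀ a with hbdef
  set f := pottsMap (s : ℂ) P with hf
  have hfa : f κ₀ a = b := (ofReal_pottsMap s P κ₀ a).symm
  have hfb : f κ₀ b = a := by rw [hf, ← ofReal_pottsMap, hcycle]
  have hne : ∀ x r : ℝ, 0 < x → 0 < r → (x : ℂ) + r ≠ 0 := fun x r hx hr => by
    exact_mod_cast (add_pos hx hr).ne'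
  have hda : HasDerivAt (f κ₀) (-(2 * (s - P) * b / ((a + s) * (a + P)) : ℝ) : ℂ) a := by
    convert! hasDerivAt_pottsMap (κ := (κ₀ : ℂ)) (hne a s ha hs) (hne a P ha hP) using 1
    rw [← hf, hfa]
    push_cast
    ring
  have hdb : HasDerivAt (f κ₀) (-(2 * (s - P) * a / ((b + s) * (b + P)) : ℝ) : ℂ) (f κ₀ a) := by
    rw [hfa]
    convert! hasDerivAt_pottsMap (κ := (κ₀ : ℂ)) (hne b s hb hs) (hne b P hb hP) using 1
    rw [← hf, hfb]
    push_cast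
    ring
  have hd := hdb.comp (a : ℂ) hda
  set m : ℂ := (-(2 * (s - P) * a / ((b + s) * (b + P)) : ℝ) : ℂ) *
    (-(2 * (s - P) * b / ((a + s) * (a + P)) : ℝ) : ℂ) with hm
  have hm1 : ‖m‖ < 1 := by
    rw [hm, neg_mul_neg, ← Complex.ofReal_mul, Complex.norm_real,
      Real.norm_of_nonneg (by positivity), div_mul_div_comm, div_lt_one (by positivity)]
    calc _ = 4 * (s - P) ^ 2 * (a * b) := by ring
      _ < _ := hmult
      _ = _ := by ring
  set ρ := (1 + ‖m‖) / 2 with hρ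
  have hcontr : ∀ᶠ u in 𝓝 (a : ℂ), ‖f κ₀ (f κ₀ u) - a‖ ≤ ρ * ‖u - a‖ := by
    filter_upwards [(hasDerivAt_iff_isLittleO.1 hd).def (by linarith : 0 < (1 - ‖m‖) / 2)]
      with u hu
    simp only [Function.comp_apply, hfa, hfb, smul_eq_mul] at hu
    have h1 := norm_le_norm_sub_add (f κ₀ (f κ₀ u) - a) ((u - a) * m)
    rw [norm_mul] at h1
    rw [hρ]
    linarith
  have hfcont : ContinuousAt (f κ₀) a := hda.continuousAt
  have hfcont' : ∀ r : ℝ, 0 < r → ∀ᶠ u in 𝓝 (a : ℂ), f κ₀ u + r ≠ 0 := fun r hr =>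
    (hfcont.add continuousAt_const).eventually_ne (by
      simp only [Pi.add_apply, hfa]; exact hne b r hb hr)
  have hidcont' : ∀ r : ℝ, 0 < r → ∀ᶠ u : ℂ in 𝓝 (a : ℂ), u + r ≠ 0 := fun r hr =>
    (continuousAt_id.add continuousAt_const).eventually_ne (hne a r ha hr)
  obtain ⟨r, hr, hball⟩ := Metric.nhds_basis_closedBall.eventually_iff.1
    ((((hidcont' P hP).and (hidcont' τ hτ)).and ((hfcont' P hP).and (hfcont' τ hτ))).and hcontr)
  refine ⟨r, hr, (isCompact_closedBall (a : ℂ) r).eventually_forall_of_forall_eventually ?_⟩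
  intro u hu
  obtain ⟨⟨⟨h1, h2⟩, h3, h4⟩, h5⟩ := hball hu
  have c1 : ContinuousAt (fun p : ℂ × ℂ => f p.1 p.2) ((κ₀ : ℂ), u) :=
    continuousAt_pottsMap_uncurry h1
  have c2 : ContinuousAt (fun p : ℂ × ℂ => f p.1 (f p.1 p.2)) ((κ₀ : ℂ), u) :=
    ContinuousAt.comp (f := fun p : ℂ × ℂ => (p.1, f p.1 p.2))
      (g := fun p : ℂ × ℂ => f p.1 p.2) (continuousAt_pottsMap_uncurry h3)
      (continuousAt_fst.prodMk c1)
  have hlt : ‖f κ₀ (f κ₀ u) - a‖ < r := by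
    have h6 : ‖u - a‖ ≤ r := by simpa [dist_eq_norm] using hu
    have hρ0 : 0 ≤ ρ := by positivity
    nlinarith [mul_le_mul_of_nonneg_left h6 hρ0]
  filter_upwards [(continuousAt_snd.add continuousAt_const).eventually_ne h1,
    (continuousAt_snd.add continuousAt_const).eventually_ne h2,
    (c1.add continuousAt_const).eventually_ne h3, (c1.add continuousAt_const).eventually_ne h4,
    (c2.sub continuousAt_const).norm.eventually_lt_const hlt] with p p1 p2 p3 p4 p5
  exact ⟨⟨p1, p2, p3, p4⟩, by rw [mem_closedBall, dist_eq_norm]; exact p5.le⟩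

theorem eventually_forall_pottsLift_ne_zero {s P τ c κ₀ : ℝ} (hP : 0 < P) (hsP : P < s)
    (hτ : 0 < τ) (hc : 0 < c) (hκ₀ : 0 < κ₀) (hmc : 2 * (s - P) * c < (c + s) * (c + P))
    (hκy : ∀ y, 0 < y → y ^ 2 - (s - 3 * P) * y + s * P = 0 → pottsParam s P y ≠ κ₀) :
    ∀ᶠ κ in 𝓝 (κ₀ : ℂ), ∀ n, (pottsLift s P c κ n).1 + τ * (pottsLift s P c κ n).2 ≠ 0 := by
  have hs : 0 < s := hP.trans hsP
  obtain ⟨a, ha, hlim, hcycle, hmult⟩ := exists_attracting_limit hP hsP hκ₀ hc hmc hκy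
  obtain ⟨r, hr, htrap⟩ := exists_trapping_ball hP hsP hτ hκ₀ ha hcycle hmult
  have hcont : ∀ n, Continuous fun κ : ℂ => pottsLift s P c κ n := fun n =>
    (differentiable_pottsLift s P c n).continuous
  obtain ⟨N, hN⟩ := (hlim.eventually (ball_mem_nhds a hr)).exists
  obtain ⟨A, B, hA, hB, hAB, hit⟩ := exists_pottsLift_ofReal hs hP hc hκ₀ (2 * N)
  have hB' : (pottsLift s P c κ₀ (2 * N)).2 ≠ 0 := by
    rw [hAB]; exact Complex.ofReal_ne_zero.2 hB.ne'
  have hstart : ∀ᶠ κ in 𝓝 (κ₀ : ℂ), (pottsLift s P c κ (2 * N)).2 ≠ 0 ∧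
      (pottsLift s P c κ (2 * N)).1 / (pottsLift s P c κ (2 * N)).2 ∈ closedBall (a : ℂ) r := by
    have h2 : ContinuousAt (fun κ : ℂ => (pottsLift s P c κ (2 * N)).2) κ₀ :=
      (hcont _).snd.continuousAt
    have h1 := ((hcont (2 * N)).fst.continuousAt (x := (κ₀ : ℂ))).div h2 hB'
    refine (h2.eventually_ne hB').and
      (h1.eventually (closedBall_mem_nhds_of_mem ?_))
    simp only [Pi.div_apply, hAB]
    rw [hit, Complex.ofReal_mul, mul_div_cancel_right₀ _ (by exact_mod_cast hB.ne'), mem_ball,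
      Complex.dist_eq, ← Complex.ofReal_sub, Complex.norm_real]
    simpa [Real.dist_eq] using hN
  have hsmall : ∀ᶠ κ in 𝓝 (κ₀ : ℂ), ∀ n ∈ Finset.range (2 * N),
      (pottsLift s P c κ n).1 + τ * (pottsLift s P c κ n).2 ≠ 0 := by
    refine (Filter.eventually_all_finset _).2 fun n _ => ?_
    refine ((hcont n).fst.add ((hcont n).snd.const_mul _)).continuousAt.eventually_ne ?_
    obtain ⟨A, B, hA, hB, hAB, -⟩ := exists_pottsLift_ofReal hs hP hc hκ₀ n
    simp only [Pi.add_apply, hAB]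
    exact_mod_cast (by positivity : 0 < A + τ * B).ne'
  filter_upwards [htrap, hstart, hsmall] with κ ht h0 hn n
  rcases lt_or_ge n (2 * N) with h | h
  · exact hn n (Finset.mem_range.2 h)
  have hrat : ∀ {v : ℂ × ℂ} {x : ℂ}, v.2 ≠ 0 → v.1 / v.2 + x ≠ 0 → v.1 + x * v.2 ≠ 0 := by
    intro v x hv hx h
    refine hx ?_
    rw [div_add' _ _ _ hv, h, zero_div]
  have hodd : ∀ {n}, (pottsLift s P c κ n).2 ≠ 0 →
      (pottsLift s P c κ n).1 / (pottsLift s P c κ n).2 ∈ closedBall (a : ℂ) r →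
      (pottsLift s P c κ (n + 1)).2 ≠ 0 ∧
        (pottsLift s P c κ (n + 1)).1 / (pottsLift s P c κ (n + 1)).2 =
          pottsMap (s : ℂ) P κ ((pottsLift s P c κ n).1 / (pottsLift s P c κ n).2) := by
    intro n h1 h2
    rw [pottsLift_succ]
    exact ⟨pow_ne_zero 2 (hrat h1 (ht _ h2).1.1), div_pottsStep h1⟩
  have heven : ∀ k, (pottsLift s P c κ (2 * (N + k))).2 ≠ 0 ∧
      (pottsLift s P c κ (2 * (N + k))).1 / (pottsLift s P c κ (2 * (N + k))).2 ∈
        closedBall (a : ℂ) r := by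
    intro k
    induction k with
    | zero => exact h0
    | succ k ih =>
      obtain ⟨o1, o2⟩ := hodd ih.1 ih.2
      have hg := ht _ ih.2
      rw [show 2 * (N + (k + 1)) = 2 * (N + k) + 1 + 1 by ring, pottsLift_succ]
      refine ⟨pow_ne_zero 2 (hrat o1 ?_), ?_⟩
      · rw [o2]; exact hg.1.2.2.1
      · rw [div_pottsStep o1, o2]; exact hg.2
  obtain ⟨k, hk⟩ : ∃ k, n = 2 * (N + k) ∨ n = 2 * (N + k) + 1 :=
    ⟨n / 2 - N, by omega⟩
  obtain ⟨h1, h2⟩ := heven k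
  rcases hk with rfl | rfl
  · exact hrat h1 (ht _ h2).1.2.1
  · obtain ⟨o1, o2⟩ := hodd h1 h2
    refine hrat o1 ?_
    rw [o2]
    exact (ht _ h2).1.2.2.2

theorem root_of_sqrt {s P r : ℝ} (hP : 0 < P) (hsP : P < s) (h9 : 9 * P ≤ s)
    (hr : r ^ 2 = (s - P) * (s - 9 * P)) :
    0 < (s - 3 * P + r) / 2 ∧
      ((s - 3 * P + r) / 2) ^ 2 - (s - 3 * P) * ((s - 3 * P + r) / 2) + s * P = 0 := by
  refine ⟨?_, by linear_combination hr / 4⟩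
  have h : |r| < s - 3 * P := abs_lt_of_sq_lt_sq (by nlinarith [mul_pos hP (hP.trans hsP)])
    (by linarith)
  linarith [(abs_lt.1 h).1]

theorem inv_pottsParam_of_sqrt {s P r t : ℝ} (hP : 0 < P) (hsP : P < s) (h9 : 9 * P ≤ s)
    (ht : 0 < t) (hr : r ^ 2 = (s - P) * (s - 9 * P)) :
    (t * pottsParam s P ((s - 3 * P + r) / 2))⁻¹ =
      (s ^ 2 - 6 * s * P - 3 * P ^ 2 - (s - P) * r) / (8 * t * P ^ 3) := by
  have hs : 0 < s := hP.trans hsP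
  obtain ⟨hy, hroot⟩ := root_of_sqrt hP hsP h9 hr
  have hκ := pottsParam_of_root hs hy hroot
  obtain ⟨h1, h2⟩ := root_bounds hP hsP hy hroot
  have hpos := pottsParam_pos hs hP hy
  generalize pottsParam s P ((s - 3 * P + r) / 2) = κ at *
  have h4 : s - (s - 3 * P + r) / 2 ≠ 0 := (sub_pos.2 h2).ne'
  rw [eq_div_iff (by positivity), inv_mul_eq_iff_eq_mul₀ (by positivity)]
  refine mul_right_cancel₀ h4 ?_
  rw [mul_right_comm (t * κ), mul_assoc t κ, hκ]
  linear_combination (t * P * (s - P) / 2) * hr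

theorem sq_sub_eq_of_root {s P y : ℝ} (hroot : y ^ 2 - (s - 3 * P) * y + s * P = 0) :
    (2 * y - (s - 3 * P)) ^ 2 = (s - P) * (s - 9 * P) := by
  linear_combination 4 * hroot

/-- The Potts partition functions, up to a common nonzero factor, are the `pottsLift` of `t`. -/
theorem exists_pottsLift_succ_eq {q : ℕ} {t s P : ℝ} (ht : 0 < t) (hP : 0 < P)
    (hsq : s = ((q : ℝ) - 1) * t ^ 2) (hPq : P = 1 + ((q : ℝ) - 2) * t) (z : ℂ) (n : ℕ) :
    ∃ w : ℂ, w ≠ 0 ∧ pottsLift s P t (t * z)⁻¹ (n + 1) =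
      (w * (t * (ZZpair q t n z).1), w * (ZZpair q t n z).2) := by
  have hsC : (s : ℂ) = ((q : ℂ) - 1) * t ^ 2 := by rw [hsq]; push_cast; ring
  have hPC : (P : ℂ) = 1 + ((q : ℂ) - 2) * t := by rw [hPq]; push_cast; ring
  induction n with
  | zero =>
    refine ⟨((t : ℂ) + P) ^ 2, pow_ne_zero 2 (by exact_mod_cast (add_pos ht hP).ne'), ?_⟩
    simp only [pottsLift_succ, pottsLift_zero, pottsStep, ZZpair, mul_inv, mul_one, Prod.mk.injEq,
      and_true, hsC, hPC]
    field_simp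
    ring
  | succ n ih =>
    obtain ⟨w, hw, h⟩ := ih
    refine ⟨w ^ 2, pow_ne_zero 2 hw, ?_⟩
    rw [pottsLift_succ, h, hsC, hPC]
    simp only [pottsStep, ZZpair, mul_inv, Prod.mk.injEq]
    constructor
    · field_simp
    · ring

theorem exists_Zrooted_eq_zero_iff {q : ℕ} {t s P τ : ℝ} (ht : 0 < t) (hP : 0 < P) (hτ : 0 < τ)
    (hsq : s = ((q : ℝ) - 1) * t ^ 2) (hPq : P = 1 + ((q : ℝ) - 2) * t)
    (hτq : τ = ((q : ℝ) - 1) * t) (z : ℂ) :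
    (∃ n, Zrooted q t n z = 0) ↔
      ∃ n, (pottsLift s P t (t * z)⁻¹ n).1 + τ * (pottsLift s P t (t * z)⁻¹ n).2 = 0 := by
  have htC : (t : ℂ) ≠ 0 := by exact_mod_cast ht.ne'
  have hτC : (τ : ℂ) = ((q : ℂ) - 1) * t := by rw [hτq]; push_cast; ring
  have key : ∀ n, (pottsLift s P t (t * z)⁻¹ (n + 1)).1 +
      τ * (pottsLift s P t (t * z)⁻¹ (n + 1)).2 = 0 ↔ Zrooted q t n z = 0 := by
    intro n
    obtain ⟨w, hw, h⟩ := exists_pottsLift_succ_eq ht hP hsq hPq z n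
    have h1 : w * (t * (ZZpair q t n z).1) + τ * (w * (ZZpair q t n z).2) =
        w * t * Zrooted q t n z := by
      rw [hτC, Zrooted]; ring
    rw [h, h1, mul_eq_zero, or_iff_right (mul_ne_zero hw htC)]
  constructor
  · rintro ⟨n, hn⟩
    exact ⟨n + 1, (key n).2 hn⟩
  · rintro ⟨_ | n, hn⟩
    · rw [pottsLift_zero] at hn
      exact absurd hn (by simp only [mul_one]; exact_mod_cast (add_pos ht hτ).ne')
    · exact ⟨n, (key n).1 hn⟩

theorem ofReal_mem_BLY_iff {q : ℕ} (hq : 3 ≤ q) {t s P x : ℝ} (ht : 1 < t)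
    (hsq : s = ((q : ℝ) - 1) * t ^ 2) (hPq : P = 1 + ((q : ℝ) - 2) * t) (hx : 0 < x) :
    (x : ℂ) ∈ BLY t q ↔
      ∃ y, 0 < y ∧ y ^ 2 - (s - 3 * P) * y + s * P = 0 ∧ x = (t * pottsParam s P y)⁻¹ := by
  have hq' : (3 : ℝ) ≤ q := by exact_mod_cast hq
  have ht0 : 0 < t := by linarith
  have hP : 0 < P := by rw [hPq]; nlinarith
  have hτ : 0 < ((q : ℝ) - 1) * t := by nlinarith
  have hsP : P < s := by
    rw [← sub_pos, show s - P = (t - 1) * (1 + ((q : ℝ) - 1) * t) by rw [hsq, hPq]; ring]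
    exact mul_pos (by linarith) (by linarith)
  have hs : 0 < s := hP.trans hsP
  have hiff := exists_Zrooted_eq_zero_iff (q := q) ht0 hP hτ hsq hPq rfl
  have htC : (t : ℂ) ≠ 0 := by exact_mod_cast ht0.ne'
  have hxC : (x : ℂ) ≠ 0 := by exact_mod_cast hx.ne'
  rw [BLY, mem_closure_iff_frequently]
  constructor
  · intro hfr
    by_contra! hno
    have hcast : (((t * x)⁻¹ : ℝ) : ℂ) = ((t : ℂ) * x)⁻¹ := by push_cast; rfl
    have hev := eventually_forall_pottsLift_ne_zero (c := t) (κ₀ := (t * x)⁻¹) hP hsP hτ ht0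
      (by positivity) (by
        have h2 : (t + s) * (t + P) - 2 * (s - P) * t =
            (1 + ((q : ℝ) - 1) * t) * t * (3 + ((q : ℝ) - 3) * t) := by rw [hsq, hPq]; ring
        have h3 : 0 < (1 + ((q : ℝ) - 1) * t) * t * (3 + ((q : ℝ) - 3) * t) := by
          positivity
        linarith)
      (fun y hy hroot h => hno y hy hroot (by rw [h, mul_inv, inv_inv]; field_simp))
    rw [hcast] at hev
    have hcont : ContinuousAt (fun z : ℂ => ((t : ℂ) * z)⁻¹) x :=
      (continuousAt_const.mul continuousAt_id).inv₀ (mul_ne_zero htC hxC)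
    refine hfr ((hcont.eventually hev).mono fun z hz hzS => ?_)
    obtain ⟨n, hn⟩ := (hiff z).1 hzS.2
    exact hz n hn
  · rintro ⟨y, hy, hroot, hxy⟩
    have hfr := frequently_exists_pottsLift_zero (c := t) hP hsP hτ ht0 hy hroot
    have hκ := pottsParam_pos hs hP hy
    have hκC : pottsParam (s : ℂ) P y ≠ 0 := by
      rw [← ofReal_pottsParam]; exact_mod_cast hκ.ne'
    have hcont : ContinuousAt (pottsParam (s : ℂ) P) y :=
      (differentiableAt_pottsParam (by exact_mod_cast (add_pos hy hs).ne')).continuousAt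
    have hlim : Tendsto (fun w : ℂ => ((t : ℂ) * pottsParam (s : ℂ) P w)⁻¹) (𝓝 (y : ℂ))
        (𝓝 (x : ℂ)) := by
      have h := ((continuousAt_const (y := (t : ℂ))).mul hcont).inv₀ (mul_ne_zero htC hκC)
      convert! h.tendsto using 2
      simp only [Pi.inv_apply, Pi.mul_apply]
      rw [hxy, ← ofReal_pottsParam]
      push_cast
      rfl
    refine hlim.frequently ((hfr.and_eventually (hcont.eventually_ne hκC)).mono ?_)
    rintro w ⟨hw, hwκ⟩
    refine ⟨inv_ne_zero (mul_ne_zero htC hwκ), (hiff _).2 ?_⟩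
    have h : ((t : ℂ) * (t * pottsParam (s : ℂ) P w)⁻¹)⁻¹ = pottsParam (s : ℂ) P w := by
      field_simp
    rwa [h]

theorem tThree_le_iff {q t : ℝ} (hq : 3 ≤ q) (ht : 1 < t) :
    tThree q ≤ t ↔ 0 ≤ (q - 1) * t ^ 2 - 9 * (1 + (q - 2) * t) := by
  have hW : 0 ≤ 9 * q ^ 2 - 32 * q + 32 := by nlinarith
  have hW2 := Real.sq_sqrt hW
  have hlt : 3 * (q - 2) < √(9 * q ^ 2 - 32 * q + 32) := Real.lt_sqrt_of_sq_lt (by nlinarith)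
  have hid : ((q - 1) * t ^ 2 - 9 * (1 + (q - 2) * t)) * (4 * (q - 1)) =
      (2 * (q - 1) * t - 9 * (q - 2) - 3 * √(9 * q ^ 2 - 32 * q + 32)) *
        (2 * (q - 1) * t - 9 * (q - 2) + 3 * √(9 * q ^ 2 - 32 * q + 32)) := by
    linear_combination 9 * hW2
  have hpos : 0 < 2 * (q - 1) * t - 9 * (q - 2) + 3 * √(9 * q ^ 2 - 32 * q + 32) := by
    have : 0 < 2 * (q - 1) * t := mul_pos (by linarith) (by linarith)
    linarith
  rw [tThree, div_le_iff₀ (by linarith),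
    ← mul_nonneg_iff_of_pos_right (by linarith : 0 < 4 * (q - 1)),
    hid, mul_nonneg_iff_of_pos_right hpos]
  constructor <;> intro h <;> linarith

end

/-- **Theorem B (rooted case).** For `q ≥ 3` and `t > 1`, the intersection of the
accumulation set of Lee–Yang zeros of the rooted binary Cayley tree with `(0,∞)` is
empty for `1 < t < t₃(q)` and equals `{z_c^−(t,q), z_c^+(t,q)}` for `t ≥ t₃(q)`. -/
theorem potts_rooted_antiferromagnetic_accumulation
    (q : ℕ) (hq : 3 ≤ q) (t : ℝ) (ht : 1 < t) :
    (t < tThree q → BLY t q ∩ posAxis = ∅) ∧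
    (tThree q ≤ t →
      BLY t q ∩ posAxis = {((zcMinus q t : ℝ) : ℂ), ((zcPlus q t : ℝ) : ℂ)}) := by
  have hq' : (3 : ℝ) ≤ q := by exact_mod_cast hq
  have ht0 : 0 < t := by linarith
  obtain ⟨s, hsq⟩ : ∃ s, s = ((q : ℝ) - 1) * t ^ 2 := ⟨_, rfl⟩
  obtain ⟨P, hPq⟩ : ∃ P, P = 1 + ((q : ℝ) - 2) * t := ⟨_, rfl⟩
  have hP : 0 < P := by rw [hPq]; nlinarith
  have hd : s - P = (t - 1) * (1 - t + q * t) := by rw [hsq, hPq]; ring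
  have hsP : P < s := by
    rw [← sub_pos, hd]
    exact mul_pos (by linarith) (by nlinarith)
  have hs : 0 < s := hP.trans hsP
  have hmem : ∀ {x : ℝ}, 0 < x → _ := fun {x} hx => ofReal_mem_BLY_iff hq ht hsq hPq hx
  have h3 : tThree q ≤ t ↔ 0 ≤ s - 9 * P := by rw [hsq, hPq]; exact tThree_le_iff hq' ht
  refine ⟨fun h => ?_, fun h => ?_⟩
  · refine Set.eq_empty_iff_forall_notMem.2 ?_
    rintro _ ⟨hz, x, hx, rfl⟩
    obtain ⟨y, hy, hroot, -⟩ := (hmem hx).1 hz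
    refine h.not_ge (h3.2 ?_)
    refine nonneg_of_mul_nonneg_right ?_ (sub_pos.2 hsP)
    rw [← sq_sub_eq_of_root hroot]
    positivity
  · have h9 := h3.1 h
    have h9' : 9 * P ≤ s := sub_nonneg.1 h9
    set r := √((s - P) * (s - 9 * P)) with hr
    have hr2 : r ^ 2 = (s - P) * (s - 9 * P) :=
      Real.sq_sqrt (mul_nonneg (sub_pos.2 hsP).le h9)
    have hr2' : (-r) ^ 2 = (s - P) * (s - 9 * P) := by rw [neg_sq, hr2]
    have hsqrt : √((t - 1) ^ 3 * (1 - t + q * t) ^ 3 *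
        (-9 + 18 * t - 9 * q * t - t ^ 2 + q * t ^ 2))
        = (s - P) * r := by
      rw [← Real.sqrt_sq (sub_pos.2 hsP).le, hr, ← Real.sqrt_mul (sq_nonneg _)]
      congr 1
      rw [show s - 9 * P = -9 + 18 * t - 9 * q * t - t ^ 2 + q * t ^ 2 by rw [hsq, hPq]; ring, hd]
      ring
    have hden : 8 * t * (1 - 2 * t + q * t) ^ 3 = 8 * t * P ^ 3 := by rw [hPq]; ring
    have hnum : -3 - 6 * ((q : ℝ) - 2) * t - 3 * (2 + (q - 2) * q) * t ^ 2
        - 6 * (q - 2) * (q - 1) * t ^ 3 + (q - 1) ^ 2 * t ^ 4 =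
        s ^ 2 - 6 * s * P - 3 * P ^ 2 := by
      rw [hsq, hPq]; ring
    have hminus : zcMinus q t = (t * pottsParam s P ((s - 3 * P + r) / 2))⁻¹ := by
      rw [inv_pottsParam_of_sqrt hP hsP h9' ht0 hr2, zcMinus, hsqrt, hden, hnum]
    have hplus : zcPlus q t = (t * pottsParam s P ((s - 3 * P + -r) / 2))⁻¹ := by
      rw [inv_pottsParam_of_sqrt hP hsP h9' ht0 hr2', zcPlus, hsqrt, hden, hnum]
      ring
    have hin : ∀ r : ℝ, r ^ 2 = (s - P) * (s - 9 * P) →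
        (((t * pottsParam s P ((s - 3 * P + r) / 2))⁻¹ : ℝ) : ℂ) ∈ BLY t q ∩ posAxis := by
      intro r hr
      obtain ⟨hy, hroot⟩ := root_of_sqrt hP hsP h9' hr
      have hx : 0 < (t * pottsParam s P ((s - 3 * P + r) / 2))⁻¹ :=
        inv_pos.2 (mul_pos ht0 (pottsParam_pos hs hP hy))
      exact ⟨(hmem hx).2 ⟨_, hy, hroot, rfl⟩, _, hx, rfl⟩
    rw [hminus, hplus]
    refine Set.Subset.antisymm ?_ ?_
    · rintro _ ⟨hz, x, hx, rfl⟩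
      obtain ⟨y, hy, hroot, hxy⟩ := (hmem hx).1 hz
      rcases sq_eq_sq_iff_eq_or_eq_neg.1 ((sq_sub_eq_of_root hroot).trans hr2.symm) with h | h
      · left
        rw [hxy, show y = (s - 3 * P + r) / 2 by linarith]
      · right
        rw [Set.mem_singleton_iff, hxy, show y = (s - 3 * P + -r) / 2 by linarith]
    · rintro _ (rfl | rfl)
      · exact hin r hr2
      · exact hin (-r) hr2'
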